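/- No bounded linear operator on the complex Banach space ℓ∞ of bounded complex sequences (with the supremum norm) is topologically transitive. -/

import Mathlib

/-- A bounded linear operator `T` on a complex Banach space `X` is topologically transitive
if for every pair `U, V` of nonempty open subsets of `X` there is a positive integer `n`
with `T^n(U) ∩ V ≠ ∅`. -/
def TopologicallyTransitive {X : Type*} [NormedAddCommGroup X] [NormedSpace ℂ X]
    (T : X →L[ℂ] X) : Prop :=
  ∀ U V : Set X, IsOpen U → IsOpen V → U.Nonempty → V.Nonempty →
    ∃ n : ℕ, 0 < n ∧ ((T ^ n) '' U ∩ V).Nonempty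

theorem exists_norm_apply_sub_smul_lt {Q : Type*} [NormedAddCommGroup Q] [NormedSpace ℂ Q]
    [CompleteSpace Q] [Nontrivial Q] (ρ : Q →L[ℂ] Q) :
    ∃ μ : ℂ, ∀ δ > 0, ∃ u : Q, ‖u‖ = 1 ∧ ‖ρ u - μ • u‖ < δ := by
  by_contra! h
  have hbelow : ∀ μ : ℂ, ∃ δ > 0, ∀ u : Q, δ * ‖u‖ ≤ ‖ρ u - μ • u‖ := by
    intro μ
    obtain ⟨δ, hδ, hu⟩ := h μ
    refine ⟨δ, hδ, fun u => ?_⟩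
    rcases eq_or_ne u 0 with rfl | hu0
    · simp
    have hpos : 0 < ‖u‖ := norm_pos_iff.mpr hu0
    have h1 := hu ((‖u‖⁻¹ : ℂ) • u) (by
      rw [norm_smul, norm_inv, Complex.norm_real, norm_norm, inv_mul_cancel₀ hpos.ne'])
    rw [map_smul, smul_comm μ, ← smul_sub, norm_smul, norm_inv, Complex.norm_real, norm_norm,
      inv_mul_eq_div, le_div_iff₀ hpos] at h1
    exact h1
  have hclosed : IsClosed (spectrum ℂ ρ)ᶜ := by
    refine isClosed_of_closure_subset fun μ hμ => ?_
    obtain ⟨δ, hδ, hb⟩ := hbelow μ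
    obtain ⟨ν, hν, hd⟩ := Metric.mem_closure_iff.mp hμ (δ / 3) (by positivity)
    rw [Set.mem_compl_iff, spectrum.notMem_iff] at hν ⊢
    obtain ⟨a, ha⟩ := hν
    have hsub : algebraMap ℂ (Q →L[ℂ] Q) μ - ρ - a = (μ - ν) • 1 := by
      rw [ha, Algebra.algebraMap_eq_smul_one, Algebra.algebraMap_eq_smul_one, sub_smul]; abel
    have hinv : ‖(↑a⁻¹ : Q →L[ℂ] Q)‖ ≤ (2 * δ / 3)⁻¹ := by
      refine ContinuousLinearMap.opNorm_le_bound _ (by positivity) fun v => ?_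
      rw [inv_mul_eq_div, le_div_iff₀ (by positivity)]
      set u := (↑a⁻¹ : Q →L[ℂ] Q) v with hu
      have hv : (a : Q →L[ℂ] Q) u = v := by
        rw [hu, ← mul_apply_eq_comp, Units.mul_inv]; rfl
      have hv' : v = -(ρ u - μ • u) - (μ - ν) • u := by
        rw [← hv, ha, Algebra.algebraMap_eq_smul_one]
        simp only [sub_smul, sub_apply, smul_apply,
          one_apply_eq_self]
        abel
      have h1 : ‖ρ u - μ • u‖ - ‖μ - ν‖ * ‖u‖ ≤ ‖v‖ := by
        rw [hv', ← norm_smul, ← norm_neg (ρ u - μ • u)]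
        exact norm_sub_norm_le _ _
      rw [dist_eq_norm] at hd
      nlinarith [hb u, norm_nonneg u]
    have hnorm : ‖algebraMap ℂ (Q →L[ℂ] Q) μ - ρ - a‖ < ‖(↑a⁻¹ : Q →L[ℂ] Q)‖⁻¹ := by
      have hpos : 0 < ‖(↑a⁻¹ : Q →L[ℂ] Q)‖ := norm_pos_iff.mpr (Units.ne_zero a⁻¹)
      rw [hsub, norm_smul, norm_one, mul_one, ← dist_eq_norm]
      refine lt_of_lt_of_le hd ?_
      rw [le_inv_comm₀ (by positivity) hpos]
      refine hinv.trans (inv_anti₀ (by positivity) (by linarith))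
    exact ⟨a.ofNearby _ hnorm, rfl⟩
  have hclopen : IsClopen (spectrum ℂ ρ) :=
    ⟨spectrum.isClosed ρ, isClosed_compl_iff.mp hclosed⟩
  rcases isClopen_iff.mp hclopen with h0 | h1
  · exact (spectrum.nonempty ρ).ne_empty h0
  · have := (spectrum.isCompact (𝕜 := ℂ) ρ)
    rw [h1] at this
    exact noncompact_univ ℂ this

section Transitive

variable {X : Type*} [NormedAddCommGroup X] [NormedSpace ℂ X]

theorem not_topologicallyTransitive_of_dual_eigenvector {T : X →L[ℂ] X} {φ : X →L[ℂ] ℂ}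
    (hφ : φ ≠ 0) {μ : ℂ} (h : ∀ x, φ (T x) = μ * φ x) : ¬ TopologicallyTransitive T := by
  intro hT
  have hpow : ∀ (n : ℕ) x, φ ((T ^ n) x) = μ ^ n * φ x := by
    intro n
    induction n with
    | zero => simp
    | succ n ih => intro x; rw [pow_succ, mul_apply_eq_comp, ih, h]; ring
  obtain ⟨x, hx⟩ : ∃ x, φ x ≠ 0 := by
    by_contra! h0
    exact hφ (ContinuousLinearMap.ext h0)
  have hU : IsOpen {x | ‖φ x‖ < 1} := isOpen_lt (by fun_prop) (by fun_prop)
  have hV : IsOpen {x | 1 < ‖φ x‖} := isOpen_lt (by fun_prop) (by fun_prop)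
  have hUn : {x | ‖φ x‖ < 1}.Nonempty := ⟨0, by simp⟩
  have hVn : {x | 1 < ‖φ x‖}.Nonempty := ⟨(2 / φ x) • x, by simp [hx]⟩
  rcases le_total ‖μ‖ 1 with hμ | hμ
  · obtain ⟨n, -, _, ⟨y, hy, rfl⟩, hy'⟩ := hT _ _ hU hV hUn hVn
    simp only [Set.mem_ofPred_eq, hpow, norm_mul, norm_pow] at hy hy'
    nlinarith [pow_le_one₀ (n := n) (norm_nonneg μ) hμ, norm_nonneg (φ y)]
  · obtain ⟨n, -, _, ⟨y, hy, rfl⟩, hy'⟩ := hT _ _ hV hU hVn hUn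
    simp only [Set.mem_ofPred_eq, hpow, norm_mul, norm_pow] at hy hy'
    nlinarith [one_le_pow₀ (n := n) hμ, norm_nonneg (φ y)]

theorem TopologicallyTransitive.denseRange_sub_smul {T : X →L[ℂ] X}
    (hT : TopologicallyTransitive T) (μ : ℂ) : DenseRange fun x => T x - μ • x := by
  set S : X →L[ℂ] X := T - μ • ContinuousLinearMap.id ℂ X with hS
  set p := (LinearMap.range (S : X →ₗ[ℂ] X)).topologicalClosure with hp
  by_contra hd
  obtain ⟨v, hv⟩ : ∃ v, v ∉ p := by
    by_contra! hall
    refine hd fun v => ?_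
    have := hall v
    rw [hp, ← SetLike.mem_coe, Submodule.topologicalClosure_coe] at this
    exact this
  have : IsClosed (p : Set X) := Submodule.isClosed_topologicalClosure _
  have hne : ‖(Submodule.Quotient.mk v : X ⧸ p)‖ ≠ 0 := by
    rw [norm_ne_zero_iff, Ne, Submodule.Quotient.mk_eq_zero]; exact hv
  obtain ⟨ψ, -, hψ⟩ := exists_dual_vector ℂ (Submodule.Quotient.mk v : X ⧸ p) hne
  refine not_topologicallyTransitive_of_dual_eigenvector (φ := ψ.comp p.mkQL) (μ := μ) ?_ ?_ hT
  · intro h0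
    have := congrArg (fun f => f v) h0
    refine hne ?_
    have h2 : ψ (Submodule.Quotient.mk v) = 0 := this
    rw [hψ] at h2
    exact Complex.ofReal_eq_zero.mp h2
  · intro x
    have h1 : S x ∈ p := Submodule.le_topologicalClosure _ ⟨x, rfl⟩
    have h2 : (ψ.comp p.mkQL) (S x) = 0 := by
      have : p.mkQL (S x) = 0 := (Submodule.Quotient.mk_eq_zero p).mpr h1
      rw [ContinuousLinearMap.comp_apply, this, map_zero]
    rw [hS, sub_apply, map_sub, sub_eq_zero] at h2
    rw [h2]; simp

end Transitive

section Rademacher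

variable {ι : Type*} [Fintype ι] [DecidableEq ι]

theorem sum_signs_mul_signs (i j : ι) :
    ∑ ε : ι → ℤˣ, (ε i : ℤ) * (ε j : ℤ) = if i = j then (Fintype.card (ι → ℤˣ) : ℤ) else 0 := by
  split_ifs with h
  · subst h
    simp [← Units.val_mul]
  · have key : ∑ ε : ι → ℤˣ, (ε i : ℤ) * (ε j : ℤ) = ∑ ε : ι → ℤˣ, -((ε i : ℤ) * (ε j : ℤ)) := by
      refine Fintype.sum_equiv (Equiv.mulLeft (Pi.mulSingle i (-1))) _ _ fun ε => ?_
      simp [Pi.mulSingle_eq_of_ne (Ne.symm h)]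
    rw [Finset.sum_neg_distrib] at key
    omega

theorem sum_sq_sum_signs_mul_le (F : (ι → ℤˣ) → ℝ) :
    ∑ j, (∑ ε, ((ε j : ℤ) : ℝ) * F ε) ^ 2 ≤ Fintype.card (ι → ℤˣ) * ∑ ε, F ε ^ 2 := by
  set N : ℝ := ((Fintype.card (ι → ℤˣ) : ℕ) : ℝ) with hN
  have hNpos : 0 < N := by rw [hN]; exact_mod_cast Fintype.card_pos
  set c : ι → ℝ := fun j => ∑ ε, ((ε j : ℤ) : ℝ) * F ε with hc
  have h1 : ∑ ε, F ε * ∑ j, ((ε j : ℤ) : ℝ) * c j = ∑ j, c j ^ 2 := by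
    simp_rw [Finset.mul_sum]
    rw [Finset.sum_comm]
    refine Finset.sum_congr rfl fun j _ => ?_
    rw [sq]
    nth_rewrite 2 [hc]
    rw [Finset.sum_mul]
    exact Finset.sum_congr rfl fun ε _ => by ring
  have h2 : ∑ ε : ι → ℤˣ, (∑ j, ((ε j : ℤ) : ℝ) * c j) ^ 2 = N * ∑ j, c j ^ 2 := by
    simp_rw [sq, Finset.sum_mul_sum]
    rw [Finset.sum_comm, Finset.mul_sum]
    refine Finset.sum_congr rfl fun i _ => ?_
    rw [Finset.sum_comm]
    have : ∀ j, ∑ ε : ι → ℤˣ, ((ε i : ℤ) : ℝ) * c i * (((ε j : ℤ) : ℝ) * c j)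
        = if i = j then N * (c i * c j) else 0 := by
      intro j
      have hs := congrArg (Int.cast : ℤ → ℝ) (sum_signs_mul_signs i j)
      push_cast at hs
      calc _ = (∑ ε : ι → ℤˣ, ((ε i : ℤ) : ℝ) * ((ε j : ℤ) : ℝ)) * (c i * c j) := by
            rw [Finset.sum_mul]; exact Finset.sum_congr rfl fun ε _ => by ring
        _ = _ := by rw [hs]; split_ifs <;> simp [hN]
    simp_rw [this]
    simp
  have h3 : 0 ≤ ∑ ε : ι → ℤˣ, (N * F ε - ∑ j, ((ε j : ℤ) : ℝ) * c j) ^ 2 :=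
    Finset.sum_nonneg fun _ _ => sq_nonneg _
  have h4 : ∑ ε : ι → ℤˣ, (N * F ε - ∑ j, ((ε j : ℤ) : ℝ) * c j) ^ 2
      = N ^ 2 * ∑ ε, F ε ^ 2 - 2 * N * ∑ j, c j ^ 2 + N * ∑ j, c j ^ 2 := by
    rw [← h2, ← h1, Finset.mul_sum, Finset.mul_sum, ← Finset.sum_sub_distrib,
      ← Finset.sum_add_distrib]
    exact Finset.sum_congr rfl fun ε _ => by ring
  rw [h4] at h3
  have h5 : 0 ≤ N * (N * ∑ ε, F ε ^ 2 - ∑ j, c j ^ 2) := by linarith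
  linarith [nonneg_of_mul_nonneg_right h5 hNpos]

theorem sum_norm_sq_sum_signs_mul_le (F : (ι → ℤˣ) → ℂ) :
    ∑ j, ‖∑ ε, ((ε j : ℤ) : ℂ) * F ε‖ ^ 2 ≤ Fintype.card (ι → ℤˣ) * ∑ ε, ‖F ε‖ ^ 2 := by
  have hr := sum_sq_sum_signs_mul_le fun ε => (F ε).re
  have hi := sum_sq_sum_signs_mul_le fun ε => (F ε).im
  have e1 : ∀ z : ℂ, ‖z‖ ^ 2 = z.re ^ 2 + z.im ^ 2 := fun z => by
    rw [Complex.sq_norm, Complex.normSq_apply]; ring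
  simp_rw [e1, Finset.sum_add_distrib, mul_add, Complex.re_sum, Complex.im_sum]
  refine le_trans (le_of_eq ?_) (add_le_add hr hi)
  simp

variable {Y Z : Type*} [NormedAddCommGroup Y] [NormedAddCommGroup Z]

theorem norm_signs_smul (u : ℤˣ) (y : Y) : ‖(u : ℤ) • y‖ = ‖y‖ := by
  rcases Int.units_eq_one_or u with rfl | rfl <;> simp

theorem norm_sum_signs_smul_le {ι : Type*} [Fintype ι] (ε : ι → ℤˣ) (v : ι → Y) :
    ‖∑ j, (ε j : ℤ) • v j‖ ≤ ∑ j, ‖v j‖ :=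
  (norm_sum_le _ _).trans (le_of_eq (by simp_rw [norm_signs_smul]))

theorem card_mul_norm_le_sum_norm_sum_signs [NormedSpace ℂ Y] (v : ι → Y) (i : ι) :
    Fintype.card (ι → ℤˣ) * ‖v i‖ ≤ ∑ ε : ι → ℤˣ, ‖∑ j, (ε j : ℤ) • v j‖ := by
  have h : (Fintype.card (ι → ℤˣ)) • v i = ∑ ε : ι → ℤˣ, (ε i : ℤ) • ∑ j, (ε j : ℤ) • v j := by
    simp_rw [Finset.smul_sum]
    rw [Finset.sum_comm]
    simp_rw [smul_smul, ← Finset.sum_smul, sum_signs_mul_signs]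
    simp only [ite_smul, zero_smul, Finset.sum_ite_eq, Finset.mem_univ, if_true, natCast_zsmul]
  calc _ = ‖(Fintype.card (ι → ℤˣ)) • v i‖ := by
        rw [← Nat.cast_smul_eq_nsmul ℂ, norm_smul, Complex.norm_natCast]
    _ ≤ _ := by
        rw [h]
        refine (norm_sum_le _ _).trans (le_of_eq ?_)
        simp_rw [norm_signs_smul]

/-- `D` has Rademacher growth at most `δ` if the average norm over all signs of
`∑ j, ± v j`, for `m` vectors in `D ∪ {0}`, is at most `δ * m + C`, with `C` independent of `m`. -/
def RademacherGrowthLE (D : Set Y) (δ : ℝ) : Prop :=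
  ∃ C : ℝ, ∀ (m : ℕ) (v : Fin m → Y), (∀ j, v j ∈ D ∨ v j = 0) →
    ∑ ε : Fin m → ℤˣ, ‖∑ j, (ε j : ℤ) • v j‖ ≤ Fintype.card (Fin m → ℤˣ) * (δ * m + C)

/-- A set is Rademacher null if it has arbitrarily small Rademacher growth. -/
def RademacherNull (D : Set Y) : Prop :=
  ∀ η > 0, RademacherGrowthLE D η

theorem RademacherGrowthLE.mono {D E : Set Y} {δ η : ℝ} (h : RademacherGrowthLE D δ)
    (hED : E ⊆ D) (hδ : δ ≤ η) : RademacherGrowthLE E η := by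
  obtain ⟨C, hC⟩ := h
  refine ⟨C, fun m v hv => (hC m v fun j => (hv j).imp_left fun h => hED h).trans ?_⟩
  gcongr

theorem RademacherGrowthLE.of_forall_exists_add {D D₁ D₂ : Set Y} {δ₁ δ₂ : ℝ}
    (h₁ : RademacherGrowthLE D₁ δ₁) (h₂ : RademacherGrowthLE D₂ δ₂)
    (h : ∀ y ∈ D, ∃ y₁ y₂, (y₁ ∈ D₁ ∨ y₁ = 0) ∧ (y₂ ∈ D₂ ∨ y₂ = 0) ∧ y = y₁ + y₂) :
    RademacherGrowthLE D (δ₁ + δ₂) := by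
  obtain ⟨C₁, hC₁⟩ := h₁
  obtain ⟨C₂, hC₂⟩ := h₂
  refine ⟨C₁ + C₂, fun m v hv => ?_⟩
  have hdec : ∀ j, ∃ y₁ y₂, (y₁ ∈ D₁ ∨ y₁ = 0) ∧ (y₂ ∈ D₂ ∨ y₂ = 0) ∧ v j = y₁ + y₂ := fun j =>
    (hv j).elim (h _) fun h0 => ⟨0, 0, Or.inr rfl, Or.inr rfl, by simp [h0]⟩
  choose a b ha hb hab using hdec
  calc ∑ ε : Fin m → ℤˣ, ‖∑ j, (ε j : ℤ) • v j‖
      ≤ ∑ ε : Fin m → ℤˣ, (‖∑ j, (ε j : ℤ) • a j‖ + ‖∑ j, (ε j : ℤ) • b j‖) := by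
        refine Finset.sum_le_sum fun ε _ => ?_
        simp_rw [hab, smul_add, Finset.sum_add_distrib]
        exact norm_add_le _ _
    _ ≤ _ := by
        rw [Finset.sum_add_distrib]
        refine (add_le_add (hC₁ m a ha) (hC₂ m b hb)).trans (le_of_eq (by ring))

theorem RademacherGrowthLE.union {D₁ D₂ : Set Y} {δ₁ δ₂ : ℝ}
    (h₁ : RademacherGrowthLE D₁ δ₁) (h₂ : RademacherGrowthLE D₂ δ₂) :
    RademacherGrowthLE (D₁ ∪ D₂) (δ₁ + δ₂) :=
  h₁.of_forall_exists_add h₂ fun y hy => hy.elim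
    (fun h => ⟨y, 0, Or.inl h, Or.inr rfl, by simp⟩)
    fun h => ⟨0, y, Or.inr rfl, Or.inl h, by simp⟩

theorem rademacherGrowthLE_closedBall {δ : ℝ} (hδ : 0 ≤ δ) :
    RademacherGrowthLE (Metric.closedBall (0 : Y) δ) δ := by
  refine ⟨0, fun m v hv => ?_⟩
  have hv' : ∀ j, ‖v j‖ ≤ δ := fun j =>
    (hv j).elim (fun h => by simpa using h) fun h => by simpa [h] using hδ
  calc _ ≤ ∑ ε : Fin m → ℤˣ, δ * m := by
        refine Finset.sum_le_sum fun ε _ => (norm_sum_signs_smul_le ε v).trans ?_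
        refine (Finset.sum_le_sum fun j _ => hv' j).trans (le_of_eq ?_)
        simp [mul_comm]
    _ = _ := by simp

theorem RademacherGrowthLE.image [NormedSpace ℂ Y] [NormedSpace ℂ Z] {D : Set Y} {δ : ℝ} (h : RademacherGrowthLE D δ)
    (L : Y →L[ℂ] Z) : RademacherGrowthLE (L '' D) (‖L‖ * δ) := by
  obtain ⟨C, hC⟩ := h
  refine ⟨‖L‖ * C, fun m v hv => ?_⟩
  have hlift : ∀ j, ∃ y, (y ∈ D ∨ y = 0) ∧ L y = v j := fun j =>
    (hv j).elim (fun ⟨y, hy, e⟩ => ⟨y, Or.inl hy, e⟩) fun h0 => ⟨0, Or.inr rfl, by simp [h0]⟩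
  choose a ha hav using hlift
  calc _ ≤ ∑ ε : Fin m → ℤˣ, ‖L‖ * ‖∑ j, (ε j : ℤ) • a j‖ := by
        refine Finset.sum_le_sum fun ε _ => ?_
        have : ∑ j, (ε j : ℤ) • v j = L (∑ j, (ε j : ℤ) • a j) := by
          simp [map_sum, map_zsmul, hav]
        rw [this]
        exact L.le_opNorm _
    _ ≤ ‖L‖ * (Fintype.card (Fin m → ℤˣ) * (δ * m + C)) := by
        rw [← Finset.mul_sum]
        exact mul_le_mul_of_nonneg_left (hC m a ha) (norm_nonneg _)
    _ = _ := by ring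

theorem rademacherNull_empty : RademacherNull (∅ : Set Y) := fun _ hη =>
  (rademacherGrowthLE_closedBall hη.le).mono (Set.empty_subset _) le_rfl

theorem RademacherNull.mono {D E : Set Y} (h : RademacherNull D) (hED : E ⊆ D) :
    RademacherNull E := fun η hη => (h η hη).mono hED le_rfl

theorem RademacherNull.of_forall_exists_add {D D₁ D₂ : Set Y} (h₁ : RademacherNull D₁)
    (h₂ : RademacherNull D₂)
    (h : ∀ y ∈ D, ∃ y₁ y₂, (y₁ ∈ D₁ ∨ y₁ = 0) ∧ (y₂ ∈ D₂ ∨ y₂ = 0) ∧ y = y₁ + y₂) :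
    RademacherNull D := fun η hη => by
  simpa using (h₁ (η / 2) (by positivity)).of_forall_exists_add (h₂ (η / 2) (by positivity)) h

theorem RademacherNull.union {D₁ D₂ : Set Y} (h₁ : RademacherNull D₁) (h₂ : RademacherNull D₂) :
    RademacherNull (D₁ ∪ D₂) := fun η hη => by
  simpa using (h₁ (η / 2) (by positivity)).union (h₂ (η / 2) (by positivity))

theorem RademacherNull.image [NormedSpace ℂ Y] [NormedSpace ℂ Z] {D : Set Y} (h : RademacherNull D) (L : Y →L[ℂ] Z) :
    RademacherNull (L '' D) := fun η hη => by
  refine ((h (η / (‖L‖ + 1)) (by positivity)).image L).mono le_rfl ?_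
  rw [mul_div_assoc', div_le_iff₀ (by positivity)]
  nlinarith [norm_nonneg L]

/-- A set of vectors is fat if it is not contained in the closed `c`-neighbourhood of a
Rademacher null set. -/
def RademacherFat (D : Set Y) (c : ℝ) : Prop :=
  ¬ ∃ E : Set Y, RademacherNull E ∧ ∀ y ∈ D, ∃ w ∈ E, ‖y - w‖ ≤ c

theorem RademacherFat.of_union {D₁ D₂ : Set Y} {c : ℝ} (h : RademacherFat (D₁ ∪ D₂) c) :
    RademacherFat D₁ c ∨ RademacherFat D₂ c := by
  by_contra! hn
  obtain ⟨h₁, h₂⟩ := hn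
  obtain ⟨E₁, hE₁, h₁⟩ := not_not.mp h₁
  obtain ⟨E₂, hE₂, h₂⟩ := not_not.mp h₂
  refine h ⟨E₁ ∪ E₂, hE₁.union hE₂, fun y hy => hy.elim (fun hy => ?_) fun hy => ?_⟩
  · obtain ⟨w, hw, e⟩ := h₁ y hy
    exact ⟨w, Or.inl hw, e⟩
  · obtain ⟨w, hw, e⟩ := h₂ y hy
    exact ⟨w, Or.inr hw, e⟩

end Rademacher

section EllInf

/-- The Banach space `ℓ∞` of bounded complex sequences. -/
abbrev EllInf : Type := lp (fun _ : ℕ => ℂ) ⊤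

theorem exists_ellInf_apply_eq (f : ℕ → ℂ) {C : ℝ} (h : ∀ n, ‖f n‖ ≤ C) :
    ∃ x : EllInf, ∀ n, x n = f n :=
  ⟨⟨f, memℓp_infty ⟨C, by rintro _ ⟨n, rfl⟩; exact h n⟩⟩, fun _ => rfl⟩

theorem EllInf.norm_apply_le (f : EllInf) (n : ℕ) : ‖f n‖ ≤ ‖f‖ :=
  lp.norm_apply_le_norm (by simp) f n

theorem EllInf.norm_le {f : EllInf} {C : ℝ} (hC : 0 ≤ C) (h : ∀ n, ‖f n‖ ≤ C) : ‖f‖ ≤ C :=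
  lp.norm_le_of_forall_le hC h

theorem EllInf.sum_apply {ι : Type*} (s : Finset ι) (f : ι → EllInf) (n : ℕ) :
    (∑ j ∈ s, f j) n = ∑ j ∈ s, f j n := by
  rw [lp.coeFn_sum, Finset.sum_apply]

theorem exists_norm_one_mul_eq_norm (z : ℂ) : ∃ c : ℂ, ‖c‖ = 1 ∧ c * z = ‖z‖ := by
  rcases eq_or_ne z 0 with rfl | hz
  · exact ⟨1, by simp⟩
  · have hz' : (‖z‖ : ℂ) ≠ 0 := by simpa using hz
    refine ⟨‖z‖ / z, ?_, div_mul_cancel₀ _ hz⟩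
    rw [norm_div, Complex.norm_real, norm_norm, div_self (by simpa using hz)]

theorem sum_norm_apply_le {ι : Type*} (s : Finset ι) (μ : EllInf →L[ℂ] ℂ) (h : ι → EllInf) {B : ℝ}
    (hB : ∀ n, ∑ j ∈ s, ‖h j n‖ ≤ B) : ∑ j ∈ s, ‖μ (h j)‖ ≤ ‖μ‖ * B := by
  choose c hc hcz using fun j => exists_norm_one_mul_eq_norm (μ (h j))
  have hB0 : 0 ≤ B := (Finset.sum_nonneg fun _ _ => norm_nonneg _).trans (hB 0)
  have h1 : ((∑ j ∈ s, ‖μ (h j)‖ : ℝ) : ℂ) = μ (∑ j ∈ s, c j • h j) := by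
    push_cast
    simp_rw [map_sum, map_smul, smul_eq_mul, hcz]
  have h2 : ‖∑ j ∈ s, c j • h j‖ ≤ B := by
    refine EllInf.norm_le hB0 fun n => ?_
    rw [EllInf.sum_apply]
    refine (norm_sum_le _ _).trans ((hB n).trans' (le_of_eq ?_))
    refine Finset.sum_congr rfl fun j _ => ?_
    rw [lp.coeFn_smul, Pi.smul_apply, norm_smul, hc, one_mul]
  calc _ = ‖((∑ j ∈ s, ‖μ (h j)‖ : ℝ) : ℂ)‖ := by
        rw [Complex.norm_real, Real.norm_of_nonneg (Finset.sum_nonneg fun _ _ => norm_nonneg _)]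
    _ ≤ _ := by
        rw [h1]
        exact (μ.le_opNorm _).trans (mul_le_mul_of_nonneg_left h2 (norm_nonneg _))

theorem bddAbove_norm_apply_dominated (μ : EllInf →L[ℂ] ℂ) (f : EllInf) :
    BddAbove (Set.range fun h : {h : EllInf // ∀ n, ‖h n‖ ≤ ‖f n‖} => ‖μ h‖) := by
  refine ⟨‖μ‖ * ‖f‖, ?_⟩
  rintro _ ⟨⟨h, hh⟩, rfl⟩
  refine (μ.le_opNorm _).trans (mul_le_mul_of_nonneg_left ?_ (norm_nonneg _))
  exact EllInf.norm_le (norm_nonneg _) fun n => (hh n).trans (f.norm_apply_le n)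

theorem EllInf.exists_dominated_add {f g h : EllInf} (hh : ∀ n, ‖h n‖ ≤ ‖(f + g) n‖) :
    ∃ a b : EllInf, h = a + b ∧ (∀ n, ‖a n‖ ≤ ‖f n‖) ∧ ∀ n, ‖b n‖ ≤ ‖g n‖ := by
  have hle : ∀ n, ‖h n‖ ≤ ‖f n‖ + ‖g n‖ := fun n => (hh n).trans (norm_add_le (f n) (g n))
  have key : ∀ x y z : ℝ, 0 ≤ x → 0 ≤ y → 0 ≤ z → z ≤ x + y → z * (x / (x + y)) ≤ x := by
    intro x y z hx hy hz hzxy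
    rcases eq_or_lt_of_le (add_nonneg hx hy) with h0 | h0
    · rw [← h0]; simpa using hx
    · rw [mul_div_assoc', div_le_iff₀ h0]
      nlinarith
  have hnorm : ∀ x y : ℝ, 0 ≤ x → 0 ≤ y → ‖((x / (x + y) : ℝ) : ℂ)‖ = x / (x + y) := by
    intro x y hx hy
    rw [Complex.norm_real, Real.norm_of_nonneg (by positivity)]
  have ha : ∀ n, ‖h n * ((‖f n‖ / (‖f n‖ + ‖g n‖) : ℝ) : ℂ)‖ ≤ ‖f n‖ := fun n => by
    rw [norm_mul, hnorm _ _ (norm_nonneg _) (norm_nonneg _)]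
    exact key _ _ _ (norm_nonneg _) (norm_nonneg _) (norm_nonneg _) (hle n)
  have hb : ∀ n, ‖h n * ((‖g n‖ / (‖g n‖ + ‖f n‖) : ℝ) : ℂ)‖ ≤ ‖g n‖ := fun n => by
    rw [norm_mul, hnorm _ _ (norm_nonneg _) (norm_nonneg _)]
    exact key _ _ _ (norm_nonneg _) (norm_nonneg _) (norm_nonneg _) ((hle n).trans_eq (add_comm _ _))
  obtain ⟨a, ha'⟩ := exists_ellInf_apply_eq _ fun n => (ha n).trans (f.norm_apply_le n)
  obtain ⟨b, hb'⟩ := exists_ellInf_apply_eq _ fun n => (hb n).trans (g.norm_apply_le n)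
  refine ⟨a, b, ?_, fun n => by rw [ha']; exact ha n, fun n => by rw [hb']; exact hb n⟩
  ext n
  rw [lp.coeFn_add, Pi.add_apply, ha', hb', ← mul_add, ← Complex.ofReal_add, add_comm ‖g n‖,
    ← add_div]
  rcases eq_or_lt_of_le (add_nonneg (norm_nonneg (f n)) (norm_nonneg (g n))) with h0 | h0
  · have : h n = 0 := norm_le_zero_iff.mp ((hle n).trans h0.symm.le)
    rw [this, zero_mul]
  · rw [div_self h0.ne', Complex.ofReal_one, mul_one]

/-- The seminorm `f ↦ |μ| |f|`, where `|μ|` is the total variation of the functional `μ`. -/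
noncomputable def totalVar (μ : EllInf →L[ℂ] ℂ) : Seminorm ℂ EllInf :=
  Seminorm.ofSMulLE (fun f => ⨆ h : {h : EllInf // ∀ n, ‖h n‖ ≤ ‖f n‖}, ‖μ h‖)
    (by
      have : ∀ h : {h : EllInf // ∀ n, ‖h n‖ ≤ ‖(0 : EllInf) n‖}, ‖μ h‖ = 0 := by
        rintro ⟨h, hh⟩
        have : h = 0 := by
          ext n
          simpa using hh n
        simp [this]
      exact (congrArg iSup (funext this)).trans (by simp))
    (by
      intro f g
      have : Nonempty {h : EllInf // ∀ n, ‖h n‖ ≤ ‖(f + g) n‖} := ⟨⟨f + g, fun _ => le_rfl⟩⟩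
      refine ciSup_le ?_
      rintro ⟨h, hh⟩
      obtain ⟨a, b, rfl, ha, hb⟩ := EllInf.exists_dominated_add hh
      rw [map_add]
      exact (norm_add_le _ _).trans (add_le_add
        (le_ciSup (bddAbove_norm_apply_dominated μ f) ⟨a, ha⟩)
        (le_ciSup (bddAbove_norm_apply_dominated μ g) ⟨b, hb⟩)))
    (by
      intro r f
      have : Nonempty {h : EllInf // ∀ n, ‖h n‖ ≤ ‖(r • f) n‖} := ⟨⟨r • f, fun _ => le_rfl⟩⟩
      refine ciSup_le ?_
      rintro ⟨h, hh⟩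
      simp only [lp.coeFn_smul, Pi.smul_apply, norm_smul] at hh
      rcases eq_or_ne r 0 with rfl | hr
      · have : h = 0 := by
          ext n
          simpa using hh n
        simp [this]
      · have hr' : 0 < ‖r‖ := norm_pos_iff.mpr hr
        have e : h = r • (r⁻¹ • h) := by rw [smul_inv_smul₀ hr]
        change ‖μ h‖ ≤ _
        rw [e, map_smul, norm_smul]
        refine mul_le_mul_of_nonneg_left ?_ hr'.le
        refine le_ciSup (bddAbove_norm_apply_dominated μ f) ⟨r⁻¹ • h, fun n => ?_⟩
        rw [lp.coeFn_smul, Pi.smul_apply, norm_smul, norm_inv, inv_mul_le_iff₀ hr']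
        exact hh n)

theorem norm_apply_le_totalVar (μ : EllInf →L[ℂ] ℂ) {f h : EllInf} (hh : ∀ n, ‖h n‖ ≤ ‖f n‖) :
    ‖μ h‖ ≤ totalVar μ f :=
  le_ciSup (bddAbove_norm_apply_dominated μ f) ⟨h, hh⟩

theorem exists_lt_norm_apply_of_lt_totalVar (μ : EllInf →L[ℂ] ℂ) {f : EllInf} {a : ℝ}
    (ha : a < totalVar μ f) : ∃ h : EllInf, (∀ n, ‖h n‖ ≤ ‖f n‖) ∧ a < ‖μ h‖ := by
  have : Nonempty {h : EllInf // ∀ n, ‖h n‖ ≤ ‖f n‖} := ⟨⟨f, fun _ => le_rfl⟩⟩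
  obtain ⟨⟨h, hh⟩, hlt⟩ := exists_lt_of_lt_ciSup ha
  exact ⟨h, hh, hlt⟩

theorem sum_totalVar_le {ι : Type*} (s : Finset ι) (μ : EllInf →L[ℂ] ℂ) (u : ι → EllInf) {B : ℝ}
    (hB : ∀ n, ∑ j ∈ s, ‖u j n‖ ≤ B) : ∑ j ∈ s, totalVar μ (u j) ≤ ‖μ‖ * B := by
  refine le_of_forall_pos_le_add fun η hη => ?_
  have hδ : 0 < η / (s.card + 1) := by positivity
  choose h hh hlt using fun j => exists_lt_norm_apply_of_lt_totalVar μ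
    (sub_lt_self (totalVar μ (u j)) hδ)
  calc ∑ j ∈ s, totalVar μ (u j) ≤ ∑ j ∈ s, (‖μ (h j)‖ + η / (s.card + 1)) :=
        Finset.sum_le_sum fun j _ => by linarith [hlt j]
    _ = ∑ j ∈ s, ‖μ (h j)‖ + s.card * (η / (s.card + 1)) := by
        rw [Finset.sum_add_distrib, Finset.sum_const, nsmul_eq_mul]
    _ ≤ _ := by
        gcongr
        · exact sum_norm_apply_le s μ h fun n =>
            (Finset.sum_le_sum fun j _ => hh j n).trans (hB n)
        · rw [mul_div_assoc', div_le_iff₀ (by positivity)]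
          nlinarith

end EllInf

section NullSets

theorem exists_norm_sub_lt_re_apply {Y : Type*} [NormedAddCommGroup Y] [NormedSpace ℂ Y]
    (μ : Y →L[ℂ] ℂ) {a : ℝ} (ha : a < ‖μ‖) : ∃ f : Y, ‖f‖ ≤ 1 ∧ μ f = ‖μ f‖ ∧ a < ‖μ f‖ := by
  obtain ⟨f, hf, haf⟩ := μ.exists_lt_apply_of_lt_opNorm ha
  obtain ⟨c, hc, hcf⟩ := exists_norm_one_mul_eq_norm (μ f)
  have h1 : ‖μ (c • f)‖ = ‖μ f‖ := by rw [map_smul, norm_smul, hc, one_mul]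
  refine ⟨c • f, by rw [norm_smul, hc, one_mul]; exact hf.le, ?_, h1.symm ▸ haf⟩
  rw [h1, map_smul, smul_eq_mul, hcf]

theorem sum_norm_sum_signs_smul_apply_le {m : ℕ} (f : (Fin m → ℤˣ) → EllInf)
    (hf : ∀ ε, ‖f ε‖ ≤ 1) (n : ℕ) :
    ∑ j, ‖(∑ ε, ((ε j : ℤ) : ℂ) • f ε) n‖ ≤ Fintype.card (Fin m → ℤˣ) * √m := by
  set N : ℝ := ((Fintype.card (Fin m → ℤˣ) : ℕ) : ℝ) with hN
  have h1 : ∀ j : Fin m, (∑ ε, ((ε j : ℤ) : ℂ) • f ε) n = ∑ ε, ((ε j : ℤ) : ℂ) * f ε n := by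
    intro j
    rw [EllInf.sum_apply]
    exact Finset.sum_congr rfl fun ε _ => by rw [lp.coeFn_smul, Pi.smul_apply, smul_eq_mul]
  simp_rw [h1]
  have h2 : ∑ ε, ‖f ε n‖ ^ 2 ≤ N := by
    calc _ ≤ ∑ ε : Fin m → ℤˣ, (1 : ℝ) := Finset.sum_le_sum fun ε _ =>
          pow_le_one₀ (norm_nonneg _) (((f ε).norm_apply_le n).trans (hf ε))
      _ = N := by simp [hN]
  have h3 := sum_norm_sq_sum_signs_mul_le fun ε => f ε n
  have h4 := sq_sum_le_card_mul_sum_sq (s := (Finset.univ : Finset (Fin m)))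
    (f := fun j => ‖∑ ε : Fin m → ℤˣ, ((ε j : ℤ) : ℂ) * f ε n‖)
  refine le_of_sq_le_sq ?_ (by positivity)
  rw [mul_pow, Real.sq_sqrt (by positivity)]
  calc _ ≤ _ := h4
    _ ≤ m * (N * N) := by
        rw [Finset.card_univ, Fintype.card_fin]
        gcongr
        exact h3.trans (by gcongr)
    _ = _ := by ring

theorem rademacherNull_setOf_le_totalVar (F : Finset (EllInf →L[ℂ] ℂ)) {K : ℝ} (hK : 0 ≤ K) :
    RademacherNull {w : EllInf →L[ℂ] ℂ | ∀ f, ‖w f‖ ≤ K * ∑ i ∈ F, totalVar i f} := by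
  intro η hη
  set A : ℝ := K * ∑ i ∈ F, ‖i‖ with hA
  refine ⟨1 + A ^ 2 / η, fun m v hv => ?_⟩
  set N : ℝ := ((Fintype.card (Fin m → ℤˣ) : ℕ) : ℝ) with hN
  have hN0 : 0 ≤ N := by positivity
  have hv' : ∀ j f, ‖v j f‖ ≤ K * ∑ i ∈ F, totalVar i f := fun j f => (hv j).elim (fun h => h f)
    fun h => by
      rw [h, zero_apply, norm_zero]
      exact mul_nonneg hK (Finset.sum_nonneg fun i _ => apply_nonneg _ _)
  choose f hf hfr hfs using fun ε : Fin m → ℤˣ => exists_norm_sub_lt_re_apply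
    (∑ j, (ε j : ℤ) • v j) (sub_one_lt ‖∑ j, (ε j : ℤ) • v j‖)
  set u : Fin m → EllInf := fun j => ∑ ε, ((ε j : ℤ) : ℂ) • f ε with hu
  have h1 : ((∑ ε, ‖(∑ j, (ε j : ℤ) • v j) (f ε)‖ : ℝ) : ℂ) = ∑ j, v j (u j) := by
    have e1 : ∀ ε, ((‖(∑ j, (ε j : ℤ) • v j) (f ε)‖ : ℝ) : ℂ)
        = ∑ j, ((ε j : ℤ) : ℂ) * v j (f ε) := fun ε => by
      rw [← hfr, sum_apply]
      exact Finset.sum_congr rfl fun j _ => by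
        rw [smul_apply, zsmul_eq_mul]
    have e2 : ∀ j, v j (u j) = ∑ ε, ((ε j : ℤ) : ℂ) * v j (f ε) := fun j => by
      rw [hu, map_sum]
      exact Finset.sum_congr rfl fun ε _ => by rw [map_smul, smul_eq_mul]
    rw [Complex.ofReal_sum]
    simp_rw [e1, e2]
    exact Finset.sum_comm
  have h2 : ∑ ε, ‖(∑ j, (ε j : ℤ) • v j) (f ε)‖ ≤ A * (N * √m) := by
    calc _ = ‖∑ j, v j (u j)‖ := by
          rw [← h1, Complex.norm_real, Real.norm_of_nonneg]
          exact Finset.sum_nonneg fun _ _ => norm_nonneg _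
      _ ≤ ∑ j, K * ∑ i ∈ F, totalVar i (u j) :=
          (norm_sum_le _ _).trans (Finset.sum_le_sum fun j _ => hv' j _)
      _ = K * ∑ i ∈ F, ∑ j, totalVar i (u j) := by
          rw [← Finset.mul_sum, Finset.sum_comm]
      _ ≤ K * ∑ i ∈ F, ‖i‖ * (N * √m) := by
          gcongr with i
          exact sum_totalVar_le _ _ _ fun n => sum_norm_sum_signs_smul_apply_le f hf n
      _ = _ := by rw [← Finset.sum_mul, hA]; ring
  have h3 : A * √m ≤ η * m + A ^ 2 / η := by
    rw [← sub_nonneg]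
    have e : η * m + A ^ 2 / η - A * √m = ((η * √m - A / 2) ^ 2 + 3 / 4 * A ^ 2) / η := by
      have hm := Real.sq_sqrt (Nat.cast_nonneg (α := ℝ) m)
      generalize √(m : ℝ) = x at hm ⊢
      rw [← hm]
      field_simp
      ring
    rw [e]
    positivity
  calc ∑ ε : Fin m → ℤˣ, ‖∑ j, (ε j : ℤ) • v j‖
      ≤ ∑ ε : Fin m → ℤˣ, (1 + ‖(∑ j, (ε j : ℤ) • v j) (f ε)‖) :=
        Finset.sum_le_sum fun ε _ => by linarith [hfs ε]
    _ ≤ N + A * (N * √m) := by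
        rw [Finset.sum_add_distrib]
        simpa [hN] using h2
    _ ≤ _ := by nlinarith

end NullSets

section Variation

theorem exists_norm_sub_le_of_norm_apply_le {Y : Type*} [NormedAddCommGroup Y] [NormedSpace ℂ Y]
    (p : Seminorm ℂ Y) (μ : Y →L[ℂ] ℂ) {c : ℝ} (hc : 0 ≤ c) (h : ∀ f, ‖μ f‖ ≤ p f + c * ‖f‖) :
    ∃ w : Y →L[ℂ] ℂ, (∀ f, ‖w f‖ ≤ p f) ∧ ‖μ - w‖ ≤ c := by
  set S : Submodule ℂ (Y × Y) := LinearMap.range (LinearMap.prod LinearMap.id LinearMap.id)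
    with hS
  set q : Seminorm ℂ (Y × Y) := p.comp (LinearMap.fst ℂ Y Y) +
    c.toNNReal • (normSeminorm ℂ Y).comp (LinearMap.snd ℂ Y Y) with hq
  have hqa : ∀ x, q x = p x.1 + c * ‖x.2‖ := fun x => by
    change p x.1 + (c.toNNReal : ℝ) * ‖x.2‖ = _
    rw [Real.coe_toNNReal _ hc]
  obtain ⟨g, hg, hgq⟩ := Module.Dual.exists_extension_of_le_seminorm S
    ((μ : Y →ₗ[ℂ] ℂ) ∘ₗ LinearMap.fst ℂ Y Y ∘ₗ S.subtype) (p := q) (by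
      rintro ⟨_, x, rfl⟩
      exact (h x).trans_eq (hqa (x, x)).symm)
  have hdiag : ∀ x, g (x, x) = μ x := fun x => hg ⟨(x, x), x, rfl⟩
  set r : Y →L[ℂ] ℂ := (g ∘ₗ LinearMap.inr ℂ Y Y).mkContinuous c fun x => by
    have := hgq (0, x)
    rw [hqa] at this
    simpa using this with hr
  refine ⟨μ - r, fun f => ?_, ?_⟩
  · have h1 : (μ - r) f = g (f, 0) := by
      rw [sub_apply, ← hdiag]
      change g (f, f) - g (0, f) = _
      rw [← map_sub]
      simp
    rw [h1]
    simpa [hqa] using hgq (f, 0)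
  · rw [sub_sub_cancel]
    exact LinearMap.mkContinuous_norm_le _ hc _

/-- The sequence which agrees with `f` on `B` and vanishes off `B`. -/
noncomputable def EllInf.restrict (B : Set ℕ) (f : EllInf) : EllInf :=
  (exists_ellInf_apply_eq (C := ‖f‖) (B.indicator fun n => f n) fun n =>
    (norm_indicator_le_norm_self _ n).trans (f.norm_apply_le n)).choose

theorem EllInf.restrict_apply (B : Set ℕ) (f : EllInf) (n : ℕ) :
    f.restrict B n = B.indicator (fun n => f n) n :=
  (exists_ellInf_apply_eq (C := ‖f‖) (B.indicator fun n => f n) fun n =>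
    (norm_indicator_le_norm_self _ n).trans (f.norm_apply_le n)).choose_spec n

theorem EllInf.restrict_apply_of_mem {B : Set ℕ} (f : EllInf) {n : ℕ} (hn : n ∈ B) :
    f.restrict B n = f n := by
  rw [restrict_apply, Set.indicator_of_mem hn]

theorem EllInf.restrict_apply_of_notMem {B : Set ℕ} (f : EllInf) {n : ℕ} (hn : n ∉ B) :
    f.restrict B n = 0 := by
  rw [restrict_apply, Set.indicator_of_notMem hn]

theorem EllInf.norm_restrict_le (B : Set ℕ) (f : EllInf) : ‖f.restrict B‖ ≤ ‖f‖ :=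
  EllInf.norm_le (norm_nonneg _) fun n => by
    rw [restrict_apply]
    exact (norm_indicator_le_norm_self _ n).trans (f.norm_apply_le n)

/-- The functional `μ` has variation at most `t` on the set `B`. -/
def VarLE (μ : EllInf →L[ℂ] ℂ) (B : Set ℕ) (t : ℝ) : Prop :=
  ∀ h : EllInf, ‖h‖ ≤ 1 → (∀ n ∉ B, h n = 0) → ‖μ h‖ ≤ t

theorem VarLE.mono {μ : EllInf →L[ℂ] ℂ} {A B : Set ℕ} {s t : ℝ} (h : VarLE μ B s) (hAB : A ⊆ B)
    (hst : s ≤ t) : VarLE μ A t :=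
  fun f hf hs => (h f hf fun n hn => hs n fun hA => hn (hAB hA)).trans hst

theorem VarLE.union {μ : EllInf →L[ℂ] ℂ} {A B : Set ℕ} {s t : ℝ} (hA : VarLE μ A s)
    (hB : VarLE μ B t) : VarLE μ (A ∪ B) (s + t) := by
  intro f hf hs
  have e : f = f.restrict A + f.restrict Aᶜ := by
    ext n
    rw [lp.coeFn_add, Pi.add_apply]
    by_cases hn : n ∈ A
    · rw [f.restrict_apply_of_mem hn, f.restrict_apply_of_notMem (not_not.mpr hn), add_zero]
    · rw [f.restrict_apply_of_notMem hn, f.restrict_apply_of_mem hn, zero_add]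
  rw [e, map_add]
  refine (norm_add_le _ _).trans (add_le_add ?_ ?_)
  · exact hA _ ((f.norm_restrict_le _).trans hf) fun n hn => f.restrict_apply_of_notMem hn
  · refine hB _ ((f.norm_restrict_le _).trans hf) fun n hn => ?_
    by_cases hnA : n ∈ A
    · exact f.restrict_apply_of_notMem (not_not.mpr hnA)
    · rw [f.restrict_apply_of_mem hnA]
      exact hs n (by simp [hnA, hn])

theorem varLE_empty (μ : EllInf →L[ℂ] ℂ) {t : ℝ} (ht : 0 ≤ t) : VarLE μ ∅ t := by
  intro f _ hs
  have : f = 0 := by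
    ext n
    exact hs n (Set.notMem_empty n)
  rw [this, map_zero, norm_zero]
  exact ht

theorem VarLE.biUnion {ι : Type*} {μ : EllInf →L[ℂ] ℂ} (s : Finset ι) {B : ι → Set ℕ} {t : ℝ}
    (h : ∀ i ∈ s, VarLE μ (B i) t) : VarLE μ (⋃ i ∈ s, B i) (s.card * t) := by
  classical
  induction s using Finset.induction_on with
  | empty => simpa using varLE_empty μ le_rfl
  | insert a s ha ih =>
    rw [Finset.set_biUnion_insert, Finset.card_insert_of_notMem ha]
    refine ((h a (Finset.mem_insert_self a s)).union
      (ih fun i hi => h i (Finset.mem_insert_of_mem hi))).mono le_rfl (le_of_eq ?_)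
    push_cast
    ring

theorem sum_norm_le_one_of_pairwise_disjoint {ι : Type*} (s : Finset ι) {A : ι → Set ℕ}
    (hA : Pairwise (Function.onFun Disjoint A)) {g : ι → EllInf} (hg : ∀ i, ‖g i‖ ≤ 1)
    (hs : ∀ i, ∀ n ∉ A i, g i n = 0) (n : ℕ) : ∑ i ∈ s, ‖g i n‖ ≤ 1 := by
  by_cases h : ∃ i ∈ s, n ∈ A i
  · obtain ⟨i, hi, hn⟩ := h
    rw [Finset.sum_eq_single_of_mem i hi fun j _ hj => ?_]
    · exact ((g i).norm_apply_le n).trans (hg i)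
    · rw [hs j n fun hnj => Set.disjoint_left.mp (hA hj) hnj hn, norm_zero]
  · push Not at h
    rw [Finset.sum_eq_zero fun j hj => by rw [hs j n (h j hj), norm_zero]]
    exact zero_le_one

theorem exists_varLE_of_pairwise_disjoint {N : ℕ} (hN : 0 < N) {A : Fin N → Set ℕ}
    (hA : Pairwise (Function.onFun Disjoint A)) {μ : EllInf →L[ℂ] ℂ} {C : ℝ} (hμ : ‖μ‖ ≤ C) :
    ∃ i, VarLE μ (A i) (C / N) := by
  by_contra! h
  simp only [VarLE, not_forall, not_le] at h
  choose f hf hs hlt using h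
  have h1 := sum_norm_apply_le Finset.univ μ f
    (sum_norm_le_one_of_pairwise_disjoint Finset.univ hA hf fun i n hn => hs i n hn)
  have : Nonempty (Fin N) := ⟨⟨0, hN⟩⟩
  have h2 : ∑ i : Fin N, C / N < ∑ i, ‖μ (f i)‖ :=
    Finset.sum_lt_sum_of_nonempty Finset.univ_nonempty fun i _ => hlt i
  rw [Finset.sum_const, Finset.card_univ, Fintype.card_fin, nsmul_eq_mul,
    mul_div_cancel₀ _ (by positivity)] at h2
  linarith

theorem RademacherFat.exists_varLE {D : Set (EllInf →L[ℂ] ℂ)} (hD : RademacherFat D (1 / 2))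
    (hD2 : ∀ μ ∈ D, ‖μ‖ ≤ 2) (F : Finset (EllInf →L[ℂ] ℂ)) {κ : ℝ} (hκ : 0 < κ) :
    ∃ μ ∈ D, ∃ (B : Set ℕ) (f : EllInf), ‖f‖ ≤ 1 ∧ (∀ n ∉ B, f n = 0) ∧ 1 / 4 ≤ ‖μ f‖ ∧
      ∀ i ∈ F, VarLE i B κ := by
  have hK : 0 < 16 / κ := by positivity
  obtain ⟨μ, hμ, hfar⟩ : ∃ μ ∈ D, ∀ w : EllInf →L[ℂ] ℂ,
      (∀ f, ‖w f‖ ≤ 16 / κ * ∑ i ∈ F, totalVar i f) → 1 / 2 < ‖μ - w‖ := by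
    by_contra! h
    exact hD ⟨_, rademacherNull_setOf_le_totalVar F hK.le, fun y hy => h y hy⟩
  set p : Seminorm ℂ EllInf := (16 / κ).toNNReal • ∑ i ∈ F, totalVar i with hp
  have hpa : ∀ f, p f = 16 / κ * ∑ i ∈ F, totalVar i f := fun f => by
    change ((16 / κ).toNNReal : ℝ) * (∑ i ∈ F, totalVar i) f = _
    rw [Real.coe_toNNReal _ hK.le, sum_apply]
  obtain ⟨f₀, hf₀⟩ : ∃ f, p f + 1 / 2 * ‖f‖ < ‖μ f‖ := by
    by_contra! h
    obtain ⟨w, hw, hle⟩ := exists_norm_sub_le_of_norm_apply_le p μ (by norm_num) h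
    exact absurd hle (not_le.mpr (hfar w fun f => (hw f).trans_eq (hpa f)))
  obtain ⟨f, hf1, hf⟩ : ∃ f, ‖f‖ = 1 ∧ p f + 1 / 2 < ‖μ f‖ := by
    have hne : f₀ ≠ 0 := by
      rintro rfl
      simp at hf₀
    have hpos : 0 < ‖f₀‖ := norm_pos_iff.mpr hne
    have hnc : ‖((‖f₀‖⁻¹ : ℝ) : ℂ)‖ = ‖f₀‖⁻¹ := by
      rw [Complex.norm_real, norm_inv, norm_norm]
    refine ⟨((‖f₀‖⁻¹ : ℝ) : ℂ) • f₀, ?_, ?_⟩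
    · rw [norm_smul, hnc, inv_mul_cancel₀ hpos.ne']
    · rw [map_smul_eq_mul, map_smul, norm_smul, hnc]
      have := mul_lt_mul_of_pos_left hf₀ (inv_pos.mpr hpos)
      rw [mul_add, mul_left_comm, inv_mul_cancel₀ hpos.ne', mul_one] at this
      exact this
  have htv : ∀ i ∈ F, totalVar i f ≤ κ / 8 := by
    intro i hi
    have h1 : totalVar i f ≤ ∑ j ∈ F, totalVar j f :=
      Finset.single_le_sum (fun j _ => apply_nonneg _ _) hi
    have h2 : ‖μ f‖ ≤ 2 := by
      have := μ.le_of_opNorm_le (hD2 μ hμ) f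
      rwa [hf1, mul_one] at this
    have h3 : 16 / κ * ∑ j ∈ F, totalVar j f ≤ 2 := by
      rw [← hpa]
      linarith
    rw [div_mul_eq_mul_div, div_le_iff₀ hκ] at h3
    linarith
  set B : Set ℕ := {n | 1 / 8 < ‖f n‖} with hB
  refine ⟨μ, hμ, B, f.restrict B, (f.norm_restrict_le B).trans hf1.le,
    fun n hn => f.restrict_apply_of_notMem hn, ?_, fun i hi h hh hs => ?_⟩
  · have h1 : ‖f - f.restrict B‖ ≤ 1 / 8 := by
      refine EllInf.norm_le (by norm_num) fun n => ?_
      rw [lp.coeFn_sub, Pi.sub_apply]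
      by_cases hn : n ∈ B
      · rw [f.restrict_apply_of_mem hn, sub_self, norm_zero]
        norm_num
      · rw [f.restrict_apply_of_notMem hn, sub_zero]
        exact not_lt.mp hn
    have h2 : ‖μ (f - f.restrict B)‖ ≤ 2 * (1 / 8) :=
      (μ.le_of_opNorm_le (hD2 μ hμ) _).trans (by gcongr)
    rw [map_sub] at h2
    have h3 := norm_sub_norm_le (μ f) (μ (f.restrict B))
    have h4 : 0 ≤ p f := apply_nonneg _ _
    linarith
  · have h1 : ∀ n, ‖h n‖ ≤ ‖((8 : ℂ) • f) n‖ := by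
      intro n
      rw [lp.coeFn_smul, Pi.smul_apply, norm_smul]
      by_cases hn : n ∈ B
      · have h2 : 1 / 8 < ‖f n‖ := hn
        have h3 := (h.norm_apply_le n).trans hh
        norm_num
        linarith
      · rw [hs n hn, norm_zero]
        positivity
    refine (norm_apply_le_totalVar i h1).trans ?_
    rw [map_smul_eq_mul]
    have := htv i hi
    norm_num
    linarith

end Variation

section Blocks

theorem RademacherFat.exists_disjoint_supports {D : Set (EllInf →L[ℂ] ℂ)}
    (hD : RademacherFat D (1 / 2)) (hD2 : ∀ μ ∈ D, ‖μ‖ ≤ 2) {A : Set ℕ}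
    (hA : ∀ μ ∈ D, VarLE μ A (1 / 16)) (M : ℕ) :
    ∃ (μ : Fin M → EllInf →L[ℂ] ℂ) (U : Fin M → Set ℕ) (g : Fin M → EllInf),
      Pairwise (Function.onFun Disjoint U) ∧ ∀ j, μ j ∈ D ∧ Disjoint (U j) A ∧ ‖g j‖ ≤ 1 ∧
        (∀ n ∉ U j, g j n = 0) ∧ 1 / 8 ≤ ‖μ j (g j)‖ := by
  classical
  set κ : ℝ := 1 / (16 * (M + 1)) with hκ
  have hκ0 : 0 < κ := by positivity
  obtain ⟨x, hx, hvar⟩ := exists_seq_of_forall_finset_exists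
    (fun x : (EllInf →L[ℂ] ℂ) × Set ℕ × EllInf =>
      x.1 ∈ D ∧ ‖x.2.2‖ ≤ 1 ∧ (∀ n ∉ x.2.1, x.2.2 n = 0) ∧ 1 / 4 ≤ ‖x.1 x.2.2‖)
    (fun x y => VarLE x.1 y.2.1 κ) (fun s _ => by
      obtain ⟨μ, hμ, B, f, hf, hs, h4, hv⟩ := hD.exists_varLE hD2 (s.image Prod.fst) hκ0
      exact ⟨(μ, B, f), ⟨hμ, hf, hs, h4⟩, fun y hy => hv _ (Finset.mem_image_of_mem _ hy)⟩)
  set V : ℕ → Set ℕ := fun j => A ∪ ⋃ k ∈ Finset.Ioo j M, (x k).2.1 with hV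
  set U : ℕ → Set ℕ := fun j => (x j).2.1 \ V j with hU
  have hdisj : ∀ j k : ℕ, k < M → j < k → Disjoint (U j) (U k) := by
    intro j k hk hjk
    refine Set.disjoint_left.mpr fun n hn hn' => hn.2 (Or.inr ?_)
    exact Set.mem_biUnion (Finset.mem_coe.mpr (Finset.mem_Ioo.mpr ⟨hjk, hk⟩)) hn'.1
  refine ⟨fun j => (x j).1, fun j => U j, fun j => (x j).2.2.restrict (U j), ?_, fun j =>
    ⟨(hx j).1, ?_, (EllInf.norm_restrict_le _ _).trans (hx j).2.1,
      fun n hn => EllInf.restrict_apply_of_notMem _ hn, ?_⟩⟩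
  · intro j k hjk
    rcases lt_or_gt_of_ne (Fin.val_ne_of_ne hjk) with h | h
    · exact hdisj _ _ k.2 h
    · exact (hdisj _ _ j.2 h).symm
  · exact Set.disjoint_left.mpr fun n hn hn' => hn.2 (Or.inl hn')
  · obtain ⟨hμ, hf, hs, h4⟩ := hx j
    set f := (x j).2.2
    set μ := (x j).1
    have hsplit : ∀ n, (f - f.restrict (U j)) n = f.restrict (U j)ᶜ n := by
      intro n
      rw [lp.coeFn_sub, Pi.sub_apply]
      by_cases hn : n ∈ U j
      · rw [f.restrict_apply_of_mem hn, f.restrict_apply_of_notMem (not_not.mpr hn), sub_self]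
      · rw [f.restrict_apply_of_notMem hn, f.restrict_apply_of_mem hn, sub_zero]
    have hvarV : VarLE μ (V j) (1 / 16 + (Finset.Ioo (j : ℕ) M).card * κ) :=
      (hA μ hμ).union (VarLE.biUnion _ fun k hk => hvar _ _ (Finset.mem_Ioo.mp hk).1)
    have h1 : ‖μ (f - f.restrict (U j))‖ ≤ 1 / 16 + (Finset.Ioo (j : ℕ) M).card * κ := by
      refine hvarV _ (EllInf.norm_le zero_le_one fun n => ?_) fun n hn => ?_
      · rw [hsplit]
        exact (EllInf.norm_apply_le _ n).trans ((f.norm_restrict_le _).trans hf)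
      · rw [hsplit]
        by_cases hnU : n ∈ U j
        · exact f.restrict_apply_of_notMem (not_not.mpr hnU)
        · rw [f.restrict_apply_of_mem hnU]
          exact hs n fun hnB => hnU ⟨hnB, hn⟩
    have h2 : (Finset.Ioo (j : ℕ) M).card * κ ≤ 1 / 16 := by
      have : ((Finset.Ioo (j : ℕ) M).card : ℝ) ≤ M + 1 := by
        rw [Nat.card_Ioo]
        exact_mod_cast (by omega : M - (j : ℕ) - 1 ≤ M + 1)
      rw [hκ, mul_one_div, div_le_div_iff₀ (by positivity) (by norm_num)]
      linarith
    rw [map_sub] at h1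
    have h3 := norm_sub_norm_le (μ f) (μ (f.restrict (U j)))
    linarith

theorem exists_block {D : Set (EllInf →L[ℂ] ℂ)} (hD2 : ∀ μ ∈ D, ‖μ‖ ≤ 2)
    (S : EllInf →L[ℂ] EllInf) {δ : ℝ} (hδ : 0 < δ)
    (hS : RademacherGrowthLE ((fun μ : EllInf →L[ℂ] ℂ => μ.comp S) '' D) δ) :
    ∃ m : ℕ, ∀ (μ : Fin m → EllInf →L[ℂ] ℂ) (U : Fin m → Set ℕ) (g : Fin m → EllInf),
      Pairwise (Function.onFun Disjoint U) → (∀ j, μ j ∈ D ∧ ‖g j‖ ≤ 1 ∧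
        (∀ n ∉ U j, g j n = 0) ∧ 1 / 8 ≤ ‖μ j (g j)‖) →
      ∃ (z : EllInf →L[ℂ] ℂ) (f : EllInf), ‖z‖ ≤ 2 ∧ ‖f‖ ≤ 1 ∧ (∀ n ∉ ⋃ j, U j, f n = 0) ∧
        1 / 16 ≤ ‖z f‖ ∧ ‖z.comp S‖ ≤ 64 * δ := by
  obtain ⟨C, hC⟩ := hS
  obtain ⟨m, hmpos, hCm⟩ : ∃ m : ℕ, (0 : ℝ) < m ∧ C ≤ δ * m := by
    obtain ⟨m, hm⟩ := exists_nat_ge (C / δ)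
    rw [div_le_iff₀ hδ] at hm
    refine ⟨m + 1, by positivity, ?_⟩
    push_cast
    linarith
  refine ⟨m, fun μ U g hU h => ?_⟩
  set N : ℝ := ((Fintype.card (Fin m → ℤˣ) : ℕ) : ℝ) with hN
  have hN0 : 0 < N := by rw [hN]; exact_mod_cast Fintype.card_pos
  set s : (Fin m → ℤˣ) → EllInf →L[ℂ] ℂ := fun ε => ∑ j, (ε j : ℤ) • μ j with hs
  have hgrow : ∑ ε, ‖(s ε).comp S‖ ≤ N * (2 * δ * m) := by
    have h1 := hC m (fun j => (μ j).comp S) fun j => Or.inl ⟨μ j, (h j).1, rfl⟩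
    have e : ∀ ε, (s ε).comp S = ∑ j, (ε j : ℤ) • (μ j).comp S := fun ε => by
      ext x
      simp [hs, sum_apply]
    simp_rw [e]
    refine h1.trans ?_
    gcongr
    linarith
  have hlow : N * (m * (1 / 8)) ≤ ∑ ε, ∑ i, ‖s ε (g i)‖ := by
    rw [Finset.sum_comm]
    calc N * (m * (1 / 8)) = ∑ i : Fin m, N * (1 / 8) := by simp; ring
      _ ≤ _ := Finset.sum_le_sum fun i _ => by
        have h1 := card_mul_norm_le_sum_norm_sum_signs (fun j => μ j (g i)) i
        refine (mul_le_mul_of_nonneg_left (h i).2.2.2 hN0.le).trans (h1.trans (le_of_eq ?_))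
        refine Finset.sum_congr rfl fun ε _ => ?_
        simp [hs, sum_apply]
  obtain ⟨ε, -, hε⟩ : ∃ ε ∈ Finset.univ,
      (m : ℝ) / 16 ≤ ∑ i, ‖s ε (g i)‖ - 1 / (32 * δ) * ‖(s ε).comp S‖ := by
    refine Finset.exists_le_of_sum_le Finset.univ_nonempty ?_
    rw [Finset.sum_sub_distrib, ← Finset.mul_sum, Finset.sum_const, nsmul_eq_mul,
      Finset.card_univ]
    have h1 : 1 / (32 * δ) * ∑ ε, ‖(s ε).comp S‖ ≤ N * m / 16 := by
      rw [one_div, inv_mul_le_iff₀ (by positivity)]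
      refine hgrow.trans (le_of_eq (by ring))
    linarith
  have hsum : ∑ i, ‖s ε (g i)‖ ≤ ‖s ε‖ * 1 := sum_norm_apply_le _ _ _
    (sum_norm_le_one_of_pairwise_disjoint _ hU (fun i => (h i).2.1) fun i => (h i).2.2.1)
  have hsn : ‖s ε‖ ≤ 2 * m := by
    refine (norm_sum_signs_smul_le ε μ).trans
      ((Finset.sum_le_sum fun j _ => hD2 _ (h j).1).trans (le_of_eq ?_))
    simp [mul_comm]
  have hnn : 0 ≤ 1 / (32 * δ) * ‖(s ε).comp S‖ := by positivity
  choose c hc hcz using fun i => exists_norm_one_mul_eq_norm (s ε (g i))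
  have hminv : ‖((m : ℂ))⁻¹‖ = (m : ℝ)⁻¹ := by rw [norm_inv, Complex.norm_natCast]
  refine ⟨(m : ℂ)⁻¹ • s ε, ∑ i, c i • g i, ?_, ?_, fun n hn => ?_, ?_, ?_⟩
  · rw [norm_smul, hminv, inv_mul_le_iff₀ hmpos]
    linarith
  · refine EllInf.norm_le zero_le_one fun n => ?_
    rw [EllInf.sum_apply]
    refine (norm_sum_le _ _).trans ((sum_norm_le_one_of_pairwise_disjoint Finset.univ hU
      (fun i => (h i).2.1) (fun i => (h i).2.2.1) n).trans' (le_of_eq ?_))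
    refine Finset.sum_congr rfl fun j _ => ?_
    rw [lp.coeFn_smul, Pi.smul_apply, norm_smul, hc, one_mul]
  · rw [EllInf.sum_apply]
    refine Finset.sum_eq_zero fun j _ => ?_
    rw [lp.coeFn_smul, Pi.smul_apply, (h j).2.2.1 n fun hj => hn (Set.mem_iUnion_of_mem j hj),
      smul_zero]
  · have h1 : s ε (∑ i, c i • g i) = ((∑ i, ‖s ε (g i)‖ : ℝ) : ℂ) := by
      push_cast
      simp_rw [map_sum, map_smul, smul_eq_mul, hcz]
    rw [smul_apply, norm_smul, hminv, h1, Complex.norm_real,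
      Real.norm_of_nonneg (Finset.sum_nonneg fun _ _ => norm_nonneg _), le_inv_mul_iff₀ hmpos]
    linarith
  · rw [ContinuousLinearMap.smul_comp, norm_smul, hminv, inv_mul_le_iff₀ hmpos]
    have h1 : 1 / (32 * δ) * ‖(s ε).comp S‖ ≤ 2 * m := by
      have : (0 : ℝ) ≤ m / 16 := by positivity
      linarith
    rw [one_div, inv_mul_le_iff₀ (by positivity)] at h1
    linarith

end Blocks

section Recursion

theorem not_rademacherFat_empty {Y : Type*} [NormedAddCommGroup Y] (c : ℝ) :
    ¬ RademacherFat (∅ : Set Y) c :=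
  not_not.mpr ⟨∅, rademacherNull_empty, fun _ h => h.elim⟩

theorem RademacherFat.mono {Y : Type*} [NormedAddCommGroup Y] {D E : Set Y} {c : ℝ}
    (h : RademacherFat D c) (hDE : D ⊆ E) : RademacherFat E c :=
  fun ⟨G, hG, hEG⟩ => h ⟨G, hG, fun y hy => hEG y (hDE hy)⟩

theorem exists_ultrafilter_rademacherFat {Y : Type*} [NormedAddCommGroup Y] {D : ℕ → Set Y}
    {c : ℝ} (hD : ∀ k, RademacherFat (D k) c) :
    ∃ 𝒰 : Ultrafilter (ℕ × Y), ∀ M ∈ 𝒰,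
      ∃ᶠ k in Filter.atTop, RademacherFat {y | y ∈ D k ∧ (k, y) ∈ M} c := by
  set p : Set (ℕ × Y) → Prop := fun M =>
    ¬ ∃ᶠ k in Filter.atTop, RademacherFat {y | y ∈ D k ∧ (k, y) ∈ M} c with hp
  set l : Filter (ℕ × Y) := Filter.comk p
    (by simp [hp, not_rademacherFat_empty])
    (fun t ht s hst h => ht (h.mono fun k hk => hk.mono fun y hy => ⟨hy.1, hst hy.2⟩))
    (fun s hs t ht h => by
      have : ∃ᶠ k in Filter.atTop, RademacherFat {y | y ∈ D k ∧ (k, y) ∈ s} c ∨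
          RademacherFat {y | y ∈ D k ∧ (k, y) ∈ t} c :=
        h.mono fun k hk => (hk.mono fun y hy => hy.2.imp (⟨hy.1, ·⟩) (⟨hy.1, ·⟩)).of_union
      exact (Filter.frequently_or_distrib.mp this).elim hs ht) with hl
  have : l.NeBot := by
    refine Filter.neBot_iff.mpr fun hbot => ?_
    have h : (∅ : Set (ℕ × Y)) ∈ l := Filter.empty_mem_iff_bot.mpr hbot
    have h' : p (∅ : Set (ℕ × Y))ᶜ := h
    refine h' (Filter.Eventually.frequently (Filter.Eventually.of_forall fun k => ?_))
    exact (hD k).mono fun y hy => ⟨hy, by simp⟩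
  refine ⟨Ultrafilter.of l, fun M hM => ?_⟩
  by_contra h
  have h1 : Mᶜ ∈ l := by
    change p Mᶜᶜ
    rwa [compl_compl]
  exact Ultrafilter.compl_notMem_iff.mpr hM (Ultrafilter.of_le l h1)

theorem exists_disjoint_block {D : ℕ → Set (EllInf →L[ℂ] ℂ)} (hD2 : ∀ k, ∀ μ ∈ D k, ‖μ‖ ≤ 2)
    (S : EllInf →L[ℂ] EllInf) {δ : ℕ → ℝ} (hδ : ∀ k, 0 < δ k) (hδa : Antitone δ)
    (hS : ∀ k, RademacherGrowthLE ((fun μ : EllInf →L[ℂ] ℂ => μ.comp S) '' D k) (δ k))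
    {𝒰 : Ultrafilter (ℕ × (EllInf →L[ℂ] ℂ))} (h𝒰 : ∀ M ∈ 𝒰,
      ∃ᶠ k in Filter.atTop, RademacherFat {y | y ∈ D k ∧ (k, y) ∈ M} (1 / 2))
    {A : Set ℕ} (hA : ∃ t < 1 / 16, ∀ᶠ p in (𝒰 : Filter (ℕ × (EllInf →L[ℂ] ℂ))), VarLE p.2 A t) (n : ℕ) :
    ∃ (B : Set ℕ) (z : EllInf →L[ℂ] ℂ) (f : EllInf),
      (∃ t < 1 / 16, ∀ᶠ p in (𝒰 : Filter (ℕ × (EllInf →L[ℂ] ℂ))), VarLE p.2 (A ∪ B) t) ∧ Disjoint B A ∧ ‖z‖ ≤ 2 ∧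
      ‖f‖ ≤ 1 ∧ (∀ n ∉ B, f n = 0) ∧ 1 / 16 ≤ ‖z f‖ ∧ ‖z.comp S‖ ≤ 64 * δ n := by
  obtain ⟨t, ht, hAt⟩ := hA
  obtain ⟨k, hk, hfat⟩ := Filter.frequently_atTop.mp (h𝒰 _ hAt) n
  set D' : Set (EllInf →L[ℂ] ℂ) := {y | y ∈ D k ∧ VarLE y A t}
  have hD2' : ∀ μ ∈ D', ‖μ‖ ≤ 2 := fun μ hμ => hD2 k μ hμ.1
  obtain ⟨m, hm⟩ := exists_block hD2' S (hδ k)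
    ((hS k).mono (Set.image_mono fun y hy => hy.1) le_rfl)
  obtain ⟨N, hN⟩ := exists_nat_gt (2 / (1 / 16 - t))
  have htp : 0 < 1 / 16 - t := by linarith
  have hN0 : (0 : ℝ) < N := lt_trans (by positivity) hN
  obtain ⟨μ, U, g, hU, hμ⟩ := RademacherFat.exists_disjoint_supports (D := D') hfat hD2'
    (fun μ hμ => hμ.2.mono le_rfl ht.le) (N * m)
  set B : Fin N → Set ℕ := fun i => ⋃ j : Fin m, U (finProdFinEquiv (i, j)) with hB
  have hBd : Pairwise (Function.onFun Disjoint B) := by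
    intro i i' hi
    refine Set.disjoint_iUnion_left.mpr fun j => Set.disjoint_iUnion_right.mpr fun j' => hU ?_
    intro h
    exact hi (congrArg Prod.fst (finProdFinEquiv.injective h))
  have hev : ∀ᶠ p in (𝒰 : Filter (ℕ × (EllInf →L[ℂ] ℂ))), ∃ i, VarLE p.2 (B i) (2 / N) := by
    by_contra hne
    obtain ⟨k', hk'⟩ := (h𝒰 _ (Ultrafilter.eventually_not.mpr hne)).exists
    refine not_rademacherFat_empty _ (hk'.mono fun y hy => hy.2 ?_)
    exact exists_varLE_of_pairwise_disjoint (Nat.cast_pos.mp hN0) hBd (hD2 _ _ hy.1)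
  obtain ⟨i, hi⟩ := Ultrafilter.eventually_exists_iff.mp hev
  obtain ⟨z, f, hz, hf, hs, hzf, hzS⟩ := hm (fun j => μ (finProdFinEquiv (i, j)))
    (fun j => U (finProdFinEquiv (i, j))) (fun j => g (finProdFinEquiv (i, j)))
    (fun j j' hj => hU fun h => hj (congrArg Prod.snd (finProdFinEquiv.injective h)))
    (fun j => ⟨(hμ _).1, (hμ _).2.2⟩)
  refine ⟨B i, z, f, ⟨t + 2 / N, ?_, ?_⟩, ?_, hz, hf, hs, hzf, hzS.trans ?_⟩
  · rw [div_lt_comm₀ htp hN0] at hN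
    linarith
  · filter_upwards [hAt, hi] with p h1 h2 using h1.union h2
  · exact Set.disjoint_iUnion_left.mpr fun j => (hμ _).2.1
  · have := hδa hk
    linarith

theorem exists_disjoint_blocks {D : ℕ → Set (EllInf →L[ℂ] ℂ)} (hD2 : ∀ k, ∀ μ ∈ D k, ‖μ‖ ≤ 2)
    (hD : ∀ k, RademacherFat (D k) (1 / 2))
    (S : EllInf →L[ℂ] EllInf) {δ : ℕ → ℝ} (hδ : ∀ k, 0 < δ k) (hδa : Antitone δ)
    (hS : ∀ k, RademacherGrowthLE ((fun μ : EllInf →L[ℂ] ℂ => μ.comp S) '' D k) (δ k)) :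
    ∃ (A : ℕ → Set ℕ) (z : ℕ → EllInf →L[ℂ] ℂ) (f : ℕ → EllInf),
      Pairwise (Function.onFun Disjoint A) ∧ ∀ n, ‖z n‖ ≤ 2 ∧ ‖f n‖ ≤ 1 ∧
        (∀ i ∉ A n, f n i = 0) ∧ 1 / 16 ≤ ‖z n (f n)‖ ∧ ‖(z n).comp S‖ ≤ 64 * δ n := by
  obtain ⟨𝒰, h𝒰⟩ := exists_ultrafilter_rademacherFat hD
  set P : Set ℕ → Prop := fun A => ∃ t < 1 / 16, ∀ᶠ p in (𝒰 : Filter (ℕ × (EllInf →L[ℂ] ℂ))), VarLE p.2 A t with hP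
  choose B z f hBP hBd hz using fun (A : {A // P A}) (n : ℕ) =>
    exists_disjoint_block hD2 S hδ hδa hS h𝒰 A.2 n
  have h0 : P ∅ := ⟨0, by norm_num, Filter.Eventually.of_forall fun p => varLE_empty _ le_rfl⟩
  set st : ℕ → {A // P A} := fun n =>
    Nat.rec ⟨∅, h0⟩ (fun n A => ⟨A ∪ B A n, hBP A n⟩) n with hst
  have hsucc : ∀ n, (st (n + 1)).1 = (st n).1 ∪ B (st n) n := fun n => rfl
  have hmono : Monotone fun n => (st n).1 :=
    monotone_nat_of_le_succ fun n => by
      rw [hsucc]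
      exact Set.subset_union_left
  have hlt : ∀ i j, i < j → Disjoint (B (st i) i) (B (st j) j) := fun i j hij => by
    refine (hBd (st j) j).symm.mono_left (le_trans ?_ (hmono hij))
    change B (st i) i ⊆ (st (i + 1)).1
    rw [hsucc]
    exact Set.subset_union_right
  refine ⟨fun n => B (st n) n, fun n => z (st n) n, fun n => f (st n) n, fun i j hij => ?_,
    fun n => hz (st n) n⟩
  rcases lt_or_gt_of_ne hij with h | h
  · exact hlt i j h
  · exact (hlt j i h).symm

end Recursion

section GlidingHump

open Filter Topology

theorem exists_varLE_subsequence {A : ℕ → Set ℕ} (hA : Pairwise (Function.onFun Disjoint A))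
    {z : ℕ → EllInf →L[ℂ] ℂ} (hz : ∀ n, ‖z n‖ ≤ 2) {F : EllInf}
    (hF : Tendsto (fun n => z n F) atTop (𝓝 0)) {φ : ℕ → ℕ} (hφ : StrictMono φ) :
    ∃ (a : ℕ) (ψ : ℕ → ℕ), StrictMono ψ ∧ Set.range ψ ⊆ Set.range φ ∧ (∀ m, φ a < ψ m) ∧
      ‖z (φ a) F‖ ≤ 1 / 64 ∧ VarLE (z (φ a)) (⋃ m, A (ψ m)) (1 / 64) := by
  have hev : ∀ᶠ a in atTop, ‖z (φ a) F‖ < 1 / 64 := by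
    have := (hF.comp hφ.tendsto_atTop).norm
    rw [norm_zero] at this
    exact this.eventually (gt_mem_nhds (by norm_num))
  obtain ⟨a, ha⟩ := hev.exists
  set ψ : Fin 128 → ℕ → ℕ := fun i m => φ (a + 1 + (m * 128 + i)) with hψ
  have hd : Pairwise (Function.onFun Disjoint fun i => ⋃ m, A (ψ i m)) := by
    intro i j hij
    refine Set.disjoint_iUnion_left.mpr fun m => Set.disjoint_iUnion_right.mpr fun m' => hA ?_
    intro h
    have := hφ.injective h
    exact hij (Fin.ext (by omega))
  obtain ⟨i, hi⟩ := exists_varLE_of_pairwise_disjoint (by norm_num) hd (hz (φ a))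
  refine ⟨a, ψ i, fun m m' h => hφ (by omega), ?_, fun m => hφ (by omega), ha.le,
    hi.mono le_rfl (by norm_num)⟩
  rintro _ ⟨m, rfl⟩
  exact ⟨_, rfl⟩

theorem not_forall_tendsto_apply_of_disjoint {A : ℕ → Set ℕ}
    (hA : Pairwise (Function.onFun Disjoint A)) {z : ℕ → EllInf →L[ℂ] ℂ} {f : ℕ → EllInf}
    (hz : ∀ n, ‖z n‖ ≤ 2) (hf : ∀ n, ‖f n‖ ≤ 1) (hs : ∀ n, ∀ i ∉ A n, f n i = 0)
    (hzf : ∀ n, 1 / 16 ≤ ‖z n (f n)‖) :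
    ¬ ∀ g, Tendsto (fun n => z n g) atTop (𝓝 0) := by
  intro hlim
  choose a ψ hψ hrange hlt hsmall hvar using fun s : {φ : ℕ → ℕ // StrictMono φ} × EllInf =>
    exists_varLE_subsequence hA hz (hlim s.2) s.1.2
  set st : ℕ → {φ : ℕ → ℕ // StrictMono φ} × EllInf := fun n =>
    Nat.rec (⟨id, strictMono_id⟩, 0) (fun _ s => (⟨ψ s, hψ s⟩, s.2 + f (s.1.1 (a s)))) n with hst
  set k : ℕ → ℕ := fun n => (st n).1.1 (a (st n)) with hk
  have hst1 : ∀ n, (st (n + 1)).1.1 = ψ (st n) := fun n => rfl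
  have hst2 : ∀ n, (st n).2 = ∑ i ∈ Finset.range n, f (k i) := by
    intro n
    induction n with
    | zero => rfl
    | succ n ih =>
      rw [Finset.sum_range_succ, ← ih]
  have hanti : Antitone fun n => Set.range (st n).1.1 := antitone_nat_of_succ_le fun n => by
    rw [hst1]
    exact hrange _
  have hmem : ∀ n j, n < j → ∃ m, ψ (st n) m = k j := fun n j hnj => by
    have : k j ∈ Set.range (st (n + 1)).1.1 := hanti (Nat.succ_le_of_lt hnj) ⟨_, rfl⟩
    rwa [hst1] at this
  have hkmono : StrictMono k := strictMono_nat_of_lt_succ fun n => by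
    obtain ⟨m, hm⟩ := hmem n (n + 1) n.lt_succ_self
    rw [← hm]
    exact hlt _ _
  have huniq : ∀ i m n, i ∈ A (k m) → i ∈ A (k n) → m = n := fun i m n hm hn => by
    by_contra h
    exact Set.disjoint_left.mp (hA (hkmono.injective.ne h)) hm hn
  obtain ⟨g, hg⟩ : ∃ g : EllInf, (∀ i, ‖g i‖ ≤ 1) ∧ (∀ n, ∀ i ∈ A (k n), g i = f (k n) i) ∧
      ∀ i, (∀ n, i ∉ A (k n)) → g i = 0 := by
    classical
    have hb : ∀ i, ‖(if h : ∃ n, i ∈ A (k n) then f (k h.choose) i else 0 : ℂ)‖ ≤ 1 := fun i => by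
      split_ifs
      · exact (EllInf.norm_apply_le _ _).trans (hf _)
      · simp
    obtain ⟨g, hg⟩ := exists_ellInf_apply_eq _ hb
    refine ⟨g, fun i => (hg i).symm ▸ hb i, fun n i hi => ?_, fun i hi => ?_⟩
    · have h : ∃ n, i ∈ A (k n) := ⟨n, hi⟩
      rw [hg, dif_pos h, huniq i _ _ h.choose_spec hi]
    · rw [hg, dif_neg (not_exists.mpr hi)]
  obtain ⟨hg1, hgA, hg0⟩ := hg
  have hlow : ∀ n, 1 / 32 ≤ ‖z (k n) g‖ := by
    intro n
    set r : EllInf := g - ∑ i ∈ Finset.range (n + 1), f (k i) with hr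
    have hra : ∀ i, r i = g i - ∑ j ∈ Finset.range (n + 1), f (k j) i := fun i => by
      rw [hr, lp.coeFn_sub, Pi.sub_apply, EllInf.sum_apply]
    have hzero : ∀ i j, i ∈ A (k j) → j ∈ Finset.range (n + 1) → r i = 0 := fun i j hi hj => by
      rw [hra, Finset.sum_eq_single_of_mem j hj fun l _ hl => hs _ _ fun h => hl (huniq i _ _ h hi),
        hgA j i hi, sub_self]
    have hsame : ∀ i, (∀ j ∈ Finset.range (n + 1), i ∉ A (k j)) → r i = g i := fun i hi => by
      rw [hra, Finset.sum_eq_zero fun j hj => hs _ _ (hi j hj), sub_zero]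
    have h1 : ‖z (k n) r‖ ≤ 1 / 64 := by
      refine hvar (st n) r (EllInf.norm_le zero_le_one fun i => ?_) fun i hi => ?_
      · by_cases h : ∃ j ∈ Finset.range (n + 1), i ∈ A (k j)
        · obtain ⟨j, hj, hij⟩ := h
          rw [hzero i j hij hj, norm_zero]
          exact zero_le_one
        · push Not at h
          rw [hsame i h]
          exact hg1 i
      · by_cases h : ∃ j, i ∈ A (k j)
        · obtain ⟨j, hij⟩ := h
          refine hzero i j hij (Finset.mem_range.mpr ?_)
          by_contra hj
          obtain ⟨m, hm⟩ := hmem n j (by omega)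
          exact hi (Set.mem_iUnion.mpr ⟨m, hm ▸ hij⟩)
        · push Not at h
          rw [hsame i fun j _ => h j, hg0 i h]
    have h2 : ‖z (k n) (∑ i ∈ Finset.range n, f (k i))‖ ≤ 1 / 64 := by
      rw [← hst2]
      exact hsmall (st n)
    have h3 : z (k n) (f (k n))
        = z (k n) g - z (k n) r - z (k n) (∑ i ∈ Finset.range n, f (k i)) := by
      rw [hr, map_sub, Finset.sum_range_succ, map_add]
      ring
    have h4 := hzf (k n)
    rw [h3] at h4
    have h5 := norm_sub_le (z (k n) g - z (k n) r) (z (k n) (∑ i ∈ Finset.range n, f (k i)))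
    have h6 := norm_sub_le (z (k n) g) (z (k n) r)
    linarith
  have hlim' := ((hlim g).comp hkmono.tendsto_atTop).norm
  rw [norm_zero] at hlim'
  have := ge_of_tendsto' hlim' hlow
  norm_num at this

end GlidingHump

section Quotient

/-- The `n`-th row of an operator on `ℓ∞`, i.e. its composition with the `n`-th coordinate
functional. -/
noncomputable def row (R : EllInf →L[ℂ] EllInf) (n : ℕ) : EllInf →L[ℂ] ℂ :=
  (lp.evalCLM ℂ (fun _ : ℕ => ℂ) ⊤ n).comp R

theorem row_apply (R : EllInf →L[ℂ] EllInf) (n : ℕ) (x : EllInf) : row R n x = R x n := rfl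

theorem norm_row_le (R : EllInf →L[ℂ] EllInf) (n : ℕ) : ‖row R n‖ ≤ ‖R‖ :=
  ContinuousLinearMap.opNorm_le_bound _ (norm_nonneg _) fun x =>
    ((R x).norm_apply_le n).trans (R.le_opNorm x)

theorem exists_row_eq {w : ℕ → EllInf →L[ℂ] ℂ} {C : ℝ} (hw : ∀ n, ‖w n‖ ≤ C) :
    ∃ W : EllInf →L[ℂ] EllInf, ∀ n, row W n = w n := by
  have hC : 0 ≤ C := (norm_nonneg _).trans (hw 0)
  have hb : ∀ x n, ‖w n x‖ ≤ C * ‖x‖ := fun x n => (w n).le_of_opNorm_le (hw n) x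
  choose W hW using fun x => exists_ellInf_apply_eq (fun n => w n x) (hb x)
  let L : EllInf →ₗ[ℂ] EllInf :=
    { toFun := W
      map_add' := fun x y => by
        ext n
        rw [lp.coeFn_add, Pi.add_apply, hW, hW, hW, map_add]
      map_smul' := fun c x => by
        ext n
        rw [RingHom.id_apply, lp.coeFn_smul, Pi.smul_apply, hW, hW, map_smul] }
  refine ⟨L.mkContinuous C fun x => EllInf.norm_le (by positivity) fun n => ?_, fun n => ?_⟩
  · exact (congrArg norm (hW x n)).trans_le (hb x n)
  · ext x
    exact hW x n

/-- The space of operators on `ℓ∞` whose rows form a Rademacher null set. -/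
noncomputable def rademacherNullOperators : Submodule ℂ (EllInf →L[ℂ] EllInf) where
  carrier := {R | RademacherNull (Set.range (row R))}
  zero_mem' := fun η hη => (rademacherGrowthLE_closedBall hη.le).mono (by
    rintro _ ⟨n, rfl⟩
    have : row 0 n = 0 := rfl
    simpa [this] using hη.le) le_rfl
  add_mem' := fun {R R'} hR hR' => by
    refine RademacherNull.of_forall_exists_add hR hR' ?_
    rintro _ ⟨n, rfl⟩
    exact ⟨row R n, row R' n, Or.inl ⟨n, rfl⟩, Or.inl ⟨n, rfl⟩, rfl⟩
  smul_mem' := fun c R hR => by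
    refine (RademacherNull.image hR (c • ContinuousLinearMap.id ℂ _)).mono ?_
    rintro _ ⟨n, rfl⟩
    exact ⟨row R n, ⟨n, rfl⟩, rfl⟩

theorem rademacherGrowthLE_range_row {R P : EllInf →L[ℂ] EllInf}
    (hP : P ∈ rademacherNullOperators) {δ η : ℝ} (hη : 0 < η) (h : ‖R - P‖ ≤ δ) :
    RademacherGrowthLE (Set.range (row R)) (η + δ) := by
  refine (hP η hη).of_forall_exists_add
    (rademacherGrowthLE_closedBall ((norm_nonneg _).trans h)) ?_
  rintro _ ⟨n, rfl⟩
  refine ⟨row P n, row (R - P) n, Or.inl ⟨n, rfl⟩, Or.inl ?_, ?_⟩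
  · rw [mem_closedBall_zero_iff]
    exact (norm_row_le _ _).trans h
  · ext x
    rw [add_apply, row_apply, row_apply, row_apply, sub_apply, lp.coeFn_sub, Pi.sub_apply,
      add_sub_cancel]

instance isClosed_rademacherNullOperators :
    IsClosed (rademacherNullOperators : Set (EllInf →L[ℂ] EllInf)) := by
  refine isClosed_of_closure_subset fun R hR η hη => ?_
  obtain ⟨P, hP, hd⟩ := Metric.mem_closure_iff.mp hR (η / 2) (by positivity)
  rw [dist_eq_norm] at hd
  simpa using rademacherGrowthLE_range_row hP (half_pos hη) hd.le

theorem comp_mem_rademacherNullOperators {R : EllInf →L[ℂ] EllInf}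
    (hR : R ∈ rademacherNullOperators) (T : EllInf →L[ℂ] EllInf) :
    R.comp T ∈ rademacherNullOperators := by
  refine (RademacherNull.image hR ((ContinuousLinearMap.compL ℂ EllInf EllInf ℂ).flip T)).mono ?_
  rintro _ ⟨n, rfl⟩
  exact ⟨row R n, ⟨n, rfl⟩, rfl⟩

theorem id_notMem_rademacherNullOperators :
    ContinuousLinearMap.id ℂ EllInf ∉ rademacherNullOperators := by
  intro h
  obtain ⟨C, hC⟩ := h (1 / 2) (by norm_num)
  obtain ⟨m, hm⟩ := exists_nat_gt (2 * C)
  have h1 := hC m (fun j => row (ContinuousLinearMap.id ℂ EllInf) j) fun j => Or.inl ⟨j, rfl⟩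
  have h2 : ∀ ε : Fin m → ℤˣ,
      (m : ℝ) ≤ ‖∑ j, (ε j : ℤ) • row (ContinuousLinearMap.id ℂ EllInf) j‖ := by
    intro ε
    have hu : ∀ u : ℤˣ, ‖((u : ℤ) : ℂ)‖ = 1 := fun u => by
      rcases Int.units_eq_one_or u with rfl | rfl <;> simp
    have hb : ∀ n, ‖(if h : n < m then ((ε ⟨n, h⟩ : ℤ) : ℂ) else 0)‖ ≤ 1 := fun n => by
      split_ifs
      · exact (hu _).le
      · simp
    obtain ⟨x, hx⟩ := exists_ellInf_apply_eq _ hb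
    have hx1 : ‖x‖ ≤ 1 := EllInf.norm_le zero_le_one fun n => (hx n).symm ▸ hb n
    have h3 : (∑ j, (ε j : ℤ) • row (ContinuousLinearMap.id ℂ EllInf) j) x = m := by
      have : ∀ j : Fin m, ((ε j : ℤ) • row (ContinuousLinearMap.id ℂ EllInf) j) x = 1 := fun j => by
        rw [smul_apply, row_apply, ContinuousLinearMap.id_apply, hx, dif_pos j.2, zsmul_eq_mul,
          ← Int.cast_mul, ← Units.val_mul, Int.units_mul_self]
        simp
      rw [sum_apply, Finset.sum_congr rfl fun j _ => this j]
      simp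
    have h4 := ContinuousLinearMap.unit_le_opNorm
      (∑ j, (ε j : ℤ) • row (ContinuousLinearMap.id ℂ EllInf) j) x hx1
    rwa [h3, Complex.norm_natCast] at h4
  have h5 := (Finset.sum_le_sum fun ε (_ : ε ∈ Finset.univ) => h2 ε).trans h1
  rw [Finset.sum_const, nsmul_eq_mul, Finset.card_univ] at h5
  have h6 := le_of_mul_le_mul_left h5 (by exact_mod_cast Fintype.card_pos)
  linarith

theorem rademacherFat_range_row {R : EllInf →L[ℂ] EllInf} {c : ℝ}
    (hR : c < ‖rademacherNullOperators.mkQ R‖) : RademacherFat (Set.range (row R)) c := by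
  rintro ⟨E, hE, h⟩
  choose w hwE hw using fun n => h (row R n) ⟨n, rfl⟩
  have hc : 0 ≤ c := (norm_nonneg _).trans (hw 0)
  obtain ⟨W, hW⟩ := exists_row_eq (w := w) (C := ‖R‖ + c) fun n => by
    have := norm_sub_norm_le (w n) (row R n)
    rw [norm_sub_rev] at this
    linarith [hw n, norm_row_le R n]
  have hWN : W ∈ rademacherNullOperators := hE.mono (by
    rintro _ ⟨n, rfl⟩
    rw [hW]
    exact hwE n)
  have h1 : rademacherNullOperators.mkQ R = rademacherNullOperators.mkQ (R - W) := by
    rw [map_sub, Submodule.mkQ_apply _ W, (Submodule.Quotient.mk_eq_zero _).mpr hWN, sub_zero]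
  have h2 : ‖R - W‖ ≤ c := ContinuousLinearMap.opNorm_le_bound _ hc fun x => by
    refine EllInf.norm_le (by positivity) fun n => ?_
    have := (row R n - w n).le_of_opNorm_le (hw n) x
    rwa [← hW] at this
  rw [h1] at hR
  exact absurd ((Submodule.Quotient.norm_mk_le _ _).trans h2) (not_le.mpr hR)

theorem rademacherGrowthLE_range_row_of_norm_lt {R : EllInf →L[ℂ] EllInf} {c : ℝ}
    (hR : ‖(Submodule.Quotient.mk R : (EllInf →L[ℂ] EllInf) ⧸ rademacherNullOperators)‖ < c) :
    RademacherGrowthLE (Set.range (row R)) c := by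
  set r := ‖(Submodule.Quotient.mk R : (EllInf →L[ℂ] EllInf) ⧸ rademacherNullOperators)‖
  obtain ⟨V, hV, hVn⟩ := Submodule.Quotient.norm_mk_lt
    (Submodule.Quotient.mk R : (EllInf →L[ℂ] EllInf) ⧸ rademacherNullOperators)
    (half_pos (sub_pos.mpr hR))
  have hP : R - V ∈ rademacherNullOperators := (Submodule.Quotient.eq _).mp hV.symm
  have h := rademacherGrowthLE_range_row hP (half_pos (sub_pos.mpr hR))
    (δ := ‖V‖) (by rw [sub_sub_cancel])
  refine h.mono subset_rfl ?_
  linarith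

theorem exists_rademacherFat_growth (T : EllInf →L[ℂ] EllInf) :
    ∃ μ : ℂ, ∀ δ > 0, ∃ D : Set (EllInf →L[ℂ] ℂ), (∀ φ ∈ D, ‖φ‖ ≤ 2) ∧ RademacherFat D (1 / 2) ∧
      RademacherGrowthLE ((fun φ : EllInf →L[ℂ] ℂ =>
        φ.comp (T - μ • ContinuousLinearMap.id ℂ EllInf)) '' D) δ := by
  have : Nontrivial ((EllInf →L[ℂ] EllInf) ⧸ rademacherNullOperators) := Submodule.Quotient.nontrivial_iff.mpr fun h =>
    id_notMem_rademacherNullOperators (by rw [h]; exact Submodule.mem_top)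
  let ρ : ((EllInf →L[ℂ] EllInf) ⧸ rademacherNullOperators) →L[ℂ] ((EllInf →L[ℂ] EllInf) ⧸ rademacherNullOperators) :=
    rademacherNullOperators.liftQL (rademacherNullOperators.mkQL.comp ((ContinuousLinearMap.compL ℂ EllInf EllInf EllInf).flip T))
      fun R hR => (Submodule.Quotient.mk_eq_zero _).mpr (comp_mem_rademacherNullOperators hR T)
  obtain ⟨μ, hμ⟩ := exists_norm_apply_sub_smul_lt
    (Q := (EllInf →L[ℂ] EllInf) ⧸ rademacherNullOperators) ρ
  refine ⟨μ, fun δ hδ => ?_⟩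
  obtain ⟨u, hu, hρ⟩ := hμ δ hδ
  obtain ⟨R, rfl, hR⟩ := Submodule.Quotient.norm_mk_lt u zero_lt_one
  have hS : ρ (Submodule.Quotient.mk R) - μ • Submodule.Quotient.mk R
      = Submodule.Quotient.mk (R.comp (T - μ • ContinuousLinearMap.id ℂ EllInf)) := by
    rw [ContinuousLinearMap.comp_sub, Submodule.Quotient.mk_sub, ContinuousLinearMap.comp_smul,
      Submodule.Quotient.mk_smul, ContinuousLinearMap.comp_id]
    rfl
  rw [hS] at hρ
  refine ⟨Set.range (row R), ?_, rademacherFat_range_row ?_, ?_⟩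
  · rintro _ ⟨n, rfl⟩
    rw [hu] at hR
    exact (norm_row_le R n).trans (by linarith)
  · rw [Submodule.mkQ_apply, hu]
    norm_num
  · refine (rademacherGrowthLE_range_row_of_norm_lt hρ).mono ?_ le_rfl
    rintro _ ⟨_, ⟨n, rfl⟩, rfl⟩
    exact ⟨n, rfl⟩

end Quotient

theorem tendsto_apply_zero_of_denseRange {X : Type*} [NormedAddCommGroup X] [NormedSpace ℂ X]
    {S : X →L[ℂ] X} (hS : DenseRange S) {z : ℕ → X →L[ℂ] ℂ} {C : ℝ} (hz : ∀ n, ‖z n‖ ≤ C)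
    (hzS : Filter.Tendsto (fun n => ‖(z n).comp S‖) Filter.atTop (nhds 0)) (g : X) :
    Filter.Tendsto (fun n => z n g) Filter.atTop (nhds 0) := by
  have hC : 0 ≤ C := (norm_nonneg _).trans (hz 0)
  refine Metric.tendsto_atTop'.mpr fun ε hε => ?_
  obtain ⟨x, hx⟩ := hS.exists_dist_lt g (ε := ε / (2 * (C + 1))) (by positivity)
  rw [dist_eq_norm] at hx
  have h0 : Filter.Tendsto (fun n => ‖(z n).comp S‖ * ‖x‖) Filter.atTop (nhds 0) := by
    simpa using hzS.mul_const ‖x‖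
  obtain ⟨n₀, hn₀⟩ := Filter.eventually_atTop.mp (h0.eventually (gt_mem_nhds (half_pos hε)))
  refine ⟨n₀, fun n hn => ?_⟩
  rw [dist_zero_right]
  have h1 : z n g = z n (g - S x) + (z n).comp S x := by
    rw [map_sub, ContinuousLinearMap.comp_apply, sub_add_cancel]
  have h2 : ‖z n (g - S x)‖ ≤ ε / 2 := by
    refine ((z n).le_of_opNorm_le (hz n) _).trans ?_
    rw [lt_div_iff₀ (by positivity)] at hx
    nlinarith [norm_nonneg (g - S x)]
  have h3 := ((z n).comp S).le_opNorm x
  have h4 := hn₀ n hn.le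
  rw [h1]
  linarith [norm_add_le (z n (g - S x)) ((z n).comp S x)]

/-- No bounded linear operator on `ℓ∞`, the Banach space of bounded complex sequences with
the supremum norm, is topologically transitive. -/
theorem not_topologicallyTransitive_ell_infty
    (T : lp (fun _ : ℕ => ℂ) ⊤ →L[ℂ] lp (fun _ : ℕ => ℂ) ⊤) :
    ¬ TopologicallyTransitive T := by
  intro hT
  obtain ⟨μ, hμ⟩ := exists_rademacherFat_growth T
  have hδ : ∀ k : ℕ, (0 : ℝ) < 1 / (k + 1) := fun k => Nat.one_div_pos_of_nat
  choose D hD2 hD hS using fun k : ℕ => hμ (1 / (k + 1)) (hδ k)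
  obtain ⟨A, z, f, hA, h⟩ := exists_disjoint_blocks hD2 hD _ hδ
    (fun _ _ h => Nat.one_div_le_one_div h) hS
  refine not_forall_tendsto_apply_of_disjoint hA (fun n => (h n).1) (fun n => (h n).2.1)
    (fun n => (h n).2.2.1) (fun n => (h n).2.2.2.1)
    (tendsto_apply_zero_of_denseRange
      (S := T - μ • ContinuousLinearMap.id ℂ EllInf) (hT.denseRange_sub_smul μ) (fun n => (h n).1) ?_)
  refine squeeze_zero (fun _ => norm_nonneg _) (fun n => (h n).2.2.2.2) ?_
  simpa using (tendsto_one_div_add_atTop_nhds_zero_nat (𝕜 := ℝ)).const_mul 64
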